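/- arXiv:1203.5455 — 2 statements merged into one kernel-verified Lean document; each statement's English description precedes it below -/
import Mathlib

section
/- Let f ∈ ℂ[z,w] be weakly nondegenerate with respect to its Newton polygon Δ_f, and suppose conv{(0,0),(ℓ,0),(0,m)} ⊆ Δ_f ⊆ [0,ℓ]×[0,m] for some integers ℓ,m ≥ 1, and that the number g of integer points in the interior of Δ_f is positive. Then for every ξ ∈ ℂ ∖ Cr_f the fiber T_ξ = {(z,w) ∈ ℂ² : f(z,w) = ξ} is nonempty and connected. -/
open MvPolynomial

/-- The set of critical values of `f ∈ ℂ[z,w]`, viewed as a polynomial map `ℂ² → ℂ`. -/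
def criticalValues (f : MvPolynomial (Fin 2) ℂ) : Set ℂ :=
  {v | ∃ p : Fin 2 → ℂ,
    eval p (pderiv 0 f) = 0 ∧ eval p (pderiv 1 f) = 0 ∧ eval p f = v}

/-- The Newton polygon of `f ∈ ℂ[z,w]`: the convex hull in `ℝ²` of the set of exponent
vectors `(ℓ,m)` of monomials of `f` with nonzero coefficient. -/
noncomputable def newtonPolygon (f : MvPolynomial (Fin 2) ℂ) : Set (ℝ × ℝ) :=
  convexHull ℝ ((fun d : Fin 2 →₀ ℕ => ((d 0 : ℝ), (d 1 : ℝ))) '' ↑f.support)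

/-- `e` is a side (one-dimensional face) of the convex set `Δ ⊆ ℝ²`: a convex extreme
subset whose affine span is one-dimensional. -/
def IsSide (Δ e : Set (ℝ × ℝ)) : Prop :=
  IsExtreme ℝ Δ e ∧ Convex ℝ e ∧ Module.finrank ℝ (affineSpan ℝ e).direction = 1

open Classical in
/-- The truncation `f_e := Σ_{(ℓ,m) ∈ e ∩ ℤ²} a_{ℓm} z^ℓ w^m` of `f` to a side `e`
of its Newton polygon. -/
noncomputable def sidePoly (f : MvPolynomial (Fin 2) ℂ) (e : Set (ℝ × ℝ)) :
    MvPolynomial (Fin 2) ℂ :=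
  ∑ d ∈ f.support.filter (fun d => (((d 0 : ℕ) : ℝ), ((d 1 : ℕ) : ℝ)) ∈ e),
    monomial d (coeff d f)

/-- `f` is weakly nondegenerate with respect to its Newton polygon: for every side `e`
of `Δ_f` not lying on a coordinate axis and every `(z,w) ∈ (ℂ∖{0})²` with `f_e(z,w) = 0`
one has `df_e(z,w) ≠ 0`. -/
def WeaklyNondegenerate (f : MvPolynomial (Fin 2) ℂ) : Prop :=
  ∀ e : Set (ℝ × ℝ), IsSide (newtonPolygon f) e →
    ¬ (e ⊆ {p : ℝ × ℝ | p.1 = 0} ∨ e ⊆ {p : ℝ × ℝ | p.2 = 0}) →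
    ∀ z w : ℂ, z ≠ 0 → w ≠ 0 → eval ![z, w] (sidePoly f e) = 0 →
      (eval ![z, w] (pderiv 0 (sidePoly f e)) ≠ 0 ∨
       eval ![z, w] (pderiv 1 (sidePoly f e)) ≠ 0)

/-- The condition `Δ_{1+z^ℓ+w^m} ⊆ Δ_f ⊆ Δ_{(1+z^ℓ)(1+w^m)}`, i.e.
`conv{(0,0),(ℓ,0),(0,m)} ⊆ Δ_f ⊆ [0,ℓ]×[0,m]`. -/
def NewtonBetween (f : MvPolynomial (Fin 2) ℂ) (ℓ m : ℕ) : Prop :=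
  convexHull ℝ {((0 : ℝ), (0 : ℝ)), ((ℓ : ℝ), (0 : ℝ)), ((0 : ℝ), (m : ℝ))} ⊆
      newtonPolygon f ∧
    newtonPolygon f ⊆ Set.Icc ((0 : ℝ), (0 : ℝ)) ((ℓ : ℝ), (m : ℝ))

/-- The number of integer points in the interior of the Newton polygon of `f`
(the genus `g`). -/
noncomputable def interiorIntPoints (f : MvPolynomial (Fin 2) ℂ) : ℕ :=
  Nat.card {p : ℤ × ℤ | (((p.1 : ℤ) : ℝ), ((p.2 : ℤ) : ℝ)) ∈ interior (newtonPolygon f)}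

open Filter Topology

section PlaneCurve

/-- Evaluation of a bivariate polynomial is a smooth function on `ℂ × ℂ`. -/
theorem contDiff_evalEval (P : Polynomial (Polynomial ℂ)) (n : WithTop ℕ∞) :
    ContDiff ℂ n fun p : ℂ × ℂ => P.evalEval p.1 p.2 := by
  have h : (fun p : ℂ × ℂ => P.evalEval p.1 p.2) = fun p : ℂ × ℂ =>
      ∑ i ∈ P.support, (Polynomial.aeval p.1 (P.coeff i) : ℂ) * p.2 ^ i := by
    funext p
    rw [Polynomial.evalEval, Polynomial.eval_eq_sum (p := P), Polynomial.sum_def,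
      Polynomial.eval_finsetSum]
    simp
  rw [h]
  exact ContDiff.sum fun i _ =>
    (((P.coeff i).contDiff_aeval n).comp contDiff_fst).mul (contDiff_snd.pow i)

theorem hasDerivAt_evalEval (P : Polynomial (Polynomial ℂ)) (z w : ℂ) :
    HasDerivAt (fun w => P.evalEval z w) (P.derivative.evalEval z w) w := by
  have := (P.map (Polynomial.evalRingHom z)).hasDerivAt w
  rw [Polynomial.derivative_map] at this
  simpa only [Polynomial.map_evalRingHom_eval] using this

/-- Near a simple root `w₀` of `P(z₀, ·)` the zero set of `P` is the graph of a function
differentiable at `z₀`. -/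
theorem exists_local_root (P : Polynomial (Polynomial ℂ)) {z₀ w₀ : ℂ}
    (h0 : P.evalEval z₀ w₀ = 0) (h1 : P.derivative.evalEval z₀ w₀ ≠ 0) :
    ∃ φ : ℂ → ℂ, φ z₀ = w₀ ∧ DifferentiableAt ℂ φ z₀ ∧ ∀ᶠ z in 𝓝 z₀, P.evalEval z (φ z) = 0 := by
  have hs : HasStrictFDerivAt (fun p : ℂ × ℂ => P.evalEval p.1 p.2) _ (z₀, w₀) :=
    (contDiff_evalEval P 1).contDiffAt.hasStrictFDerivAt one_ne_zero
  set D := fderiv ℂ (fun p : ℂ × ℂ => P.evalEval p.1 p.2) (z₀, w₀)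
  have hD : D ∘L .inr ℂ ℂ ℂ =
      ContinuousLinearMap.toSpanSingleton ℂ (P.derivative.evalEval z₀ w₀) := by
    have hc : HasFDerivAt (fun w => P.evalEval z₀ w) (D ∘L .inr ℂ ℂ ℂ) w₀ :=
      hs.hasFDerivAt.comp w₀ (hasFDerivAt_prodMk_right z₀ w₀)
    exact hc.unique (hasDerivAt_evalEval P z₀ w₀).hasFDerivAt
  have hinv : (D ∘L .inr ℂ ℂ ℂ).IsInvertible := by
    rw [hD]
    refine ⟨ContinuousLinearEquiv.unitsEquivAut ℂ (Units.mk0 _ h1), ?_⟩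
    ext
    simp
  have hu : ∀ᶠ x in 𝓝 z₀, P.evalEval x (hs.implicitFunctionOfProdDomain hinv x) = 0 := by
    simpa [h0] using hs.eventually_apply_implicitFunctionOfProdDomain hinv
  refine ⟨hs.implicitFunctionOfProdDomain hinv, ?_, ?_, hu⟩
  · exact (hs.eventually_apply_eq_iff_implicitFunctionOfProdDomain hinv).self_of_nhds.mp rfl
  · exact (hs.hasStrictFDerivAt_implicitFunctionOfProdDomain hinv).hasFDerivAt.differentiableAt

/-- Roots of `P(z₀, ·)` persist: if `P(z₀, ·)` is not identically zero, a root `w₀` of it is a limit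
of roots of `P(z, ·)` as `z → z₀`. -/
theorem eventually_exists_root_near (P : Polynomial (Polynomial ℂ)) {z₀ w₀ : ℂ}
    (h0 : P.evalEval z₀ w₀ = 0) (hne : P.map (Polynomial.evalRingHom z₀) ≠ 0)
    {s : Set ℂ} (hs : s ∈ 𝓝 w₀) : ∀ᶠ z in 𝓝 z₀, ∃ w ∈ s, P.evalEval z w = 0 := by
  have hfin : {w | P.evalEval z₀ w = 0}.Finite := by
    refine (Polynomial.finite_setOfPred_isRoot hne).subset fun w hw => ?_
    simpa [Polynomial.IsRoot, Polynomial.map_evalRingHom_eval] using hw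
  have hiso : ∀ᶠ w in 𝓝 w₀, w ≠ w₀ → P.evalEval z₀ w ≠ 0 := by
    have := (hfin.subset (Set.sdiff_subset (t := {w₀}))).isClosed.isOpen_compl.mem_nhds
      (x := w₀) (by simp)
    filter_upwards [this] with w hw hne h
    exact hw ⟨h, hne⟩
  obtain ⟨r, hr, hball⟩ := Metric.nhds_basis_closedBall.mem_iff.1 (inter_mem hs hiso)
  have hcont := (contDiff_evalEval P 0).continuous
  have hsph : (Metric.sphere w₀ r).Nonempty := NormedSpace.sphere_nonempty.2 hr.le
  obtain ⟨w₁, hw₁, hmin⟩ := (isCompact_sphere w₀ r).exists_isMinOn hsph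
    (f := fun w => ‖P.evalEval z₀ w‖)
    (hcont.norm.comp (Continuous.prodMk_right z₀)).continuousOn
  set c := ‖P.evalEval z₀ w₁‖
  have hc : 0 < c := norm_pos_iff.2 <| (hball (Metric.sphere_subset_closedBall hw₁)).2 <| by
    rintro rfl
    simp at hw₁
    exact hr.ne hw₁
  have hA : ∀ᶠ z in 𝓝 z₀, ∀ w ∈ Metric.sphere w₀ r, c / 2 < ‖P.evalEval z w‖ := by
    refine (isCompact_sphere w₀ r).eventually_forall_of_forall_eventually fun w hw => ?_
    refine (hcont.norm.tendsto (z₀, w)).eventually_const_lt ?_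
    have : c ≤ ‖P.evalEval z₀ w‖ := hmin hw
    linarith
  have hB : ∀ᶠ z in 𝓝 z₀, ‖P.evalEval z w₀‖ < c / 2 := by
    have : Tendsto (fun z => ‖P.evalEval z w₀‖) (𝓝 z₀) (𝓝 ‖P.evalEval z₀ w₀‖) :=
      (hcont.norm.comp (Continuous.prodMk_left w₀)).tendsto z₀
    refine this.eventually_lt_const ?_
    rw [h0, norm_zero]
    positivity
  filter_upwards [hA, hB] with z hzA hzB
  by_contra! hno
  have hno' : ∀ w ∈ Metric.closedBall w₀ r, P.evalEval z w ≠ 0 := fun w hw => hno w (hball hw).1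
  have hd : DiffContOnCl ℂ (fun w => (P.evalEval z w)⁻¹) (Metric.ball w₀ r) := by
    apply DifferentiableOn.diffContOnCl
    rw [closure_ball _ hr.ne']
    intro w hw
    exact ((hasDerivAt_evalEval P z w).differentiableAt.inv
      (hno' w hw)).differentiableWithinAt
  have hmax := Complex.norm_le_of_forall_mem_frontier_norm_le Metric.isBounded_ball hd
    (C := (c / 2)⁻¹) (z := w₀) (by
      intro w hw
      rw [frontier_ball _ hr.ne'] at hw
      rw [norm_inv]
      exact inv_anti₀ (by positivity) (hzA w hw).le) (subset_closure (Metric.mem_ball_self hr))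
  rw [norm_inv] at hmax
  have h3 : 0 < ‖P.evalEval z w₀‖ := norm_pos_iff.2 (hno' w₀ (Metric.mem_closedBall_self hr.le))
  have := (inv_le_inv₀ h3 (by positivity)).1 hmax
  linarith

/-- A bounded holomorphic function on the complement of a finite set is constant. -/
theorem exists_const_of_bounded_off_finite {S : Set ℂ} (hS : S.Finite) :
    ∀ (g : ℂ → ℂ) (M : ℝ), (∀ z ∉ S, DifferentiableAt ℂ g z) → (∀ z ∉ S, ‖g z‖ ≤ M) →
      ∃ c, ∀ z ∉ S, g z = c := by
  induction S, hS using Set.Finite.induction_on with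
  | empty =>
    intro g M hd hb
    have hd' : Differentiable ℂ g := fun z => hd z (Set.notMem_empty z)
    have hbd : Bornology.IsBounded (Set.range g) := by
      refine isBounded_iff_forall_norm_le.2 ⟨M, ?_⟩
      rintro _ ⟨z, rfl⟩
      exact hb z (Set.notMem_empty z)
    exact ⟨g 0, fun z _ => hd'.apply_eq_apply_of_bounded hbd z 0⟩
  | @insert a S ha hS ih =>
    intro g M hd hb
    have hopen : IsOpen Sᶜ := hS.isClosed.isOpen_compl
    have hnh : Sᶜ ∈ 𝓝 a := hopen.mem_nhds ha
    have key := Complex.differentiableOn_update_limUnder_of_bddAbove (f := g) hnh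
      (fun z hz => (hd z (by
        rintro (h | h)
        exacts [hz.2 h, hz.1 h])).differentiableWithinAt)
      ⟨M, by
        rintro _ ⟨z, hz, rfl⟩
        exact hb z (by
          rintro (h | h)
          exacts [hz.2 h, hz.1 h])⟩
    set g' := Function.update g a (limUnder (𝓝[≠] a) g)
    have hg' : ∀ z, z ≠ a → g' z = g z := fun z hz => Function.update_of_ne hz _ _
    have hda : ∀ z ∉ S, DifferentiableAt ℂ g' z := fun z hz =>
      key.differentiableAt (hopen.mem_nhds hz)
    have hev : ∀ᶠ z in 𝓝[≠] a, ‖g' z‖ ≤ M := by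
      filter_upwards [self_mem_nhdsWithin, mem_nhdsWithin_of_mem_nhds hnh] with z hz hzS
      rw [hg' z hz]
      exact hb z (by
        rintro (h | h)
        exacts [hz h, hzS h])
    have hM : ∀ z ∉ S, ‖g' z‖ ≤ M := by
      intro z hz
      by_cases h : z = a
      · subst h
        exact le_of_tendsto ((hda z hz).continuousAt.norm.tendsto.mono_left nhdsWithin_le_nhds) hev
      · rw [hg' z h]
        exact hb z (by
          rintro (h' | h')
          exacts [h h', hz h'])
    obtain ⟨c, hc⟩ := ih g' M hda hM
    refine ⟨c, fun z hz => ?_⟩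
    rw [← hg' z fun h => hz (Or.inl h)]
    exact hc z fun h => hz (Or.inr h)

/-- The finite set of roots of `P(z, ·)`. -/
noncomputable def fiberRoots (P : Polynomial (Polynomial ℂ)) (z : ℂ) : Finset ℂ :=
  (P.map (Polynomial.evalRingHom z)).roots.toFinset

theorem mem_fiberRoots {P : Polynomial (Polynomial ℂ)} {z w : ℂ}
    (hv : P.map (Polynomial.evalRingHom z) ≠ 0) :
    w ∈ fiberRoots P z ↔ P.evalEval z w = 0 := by
  simp [fiberRoots, hv, Polynomial.IsRoot, Polynomial.map_evalRingHom_eval]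

theorem card_fiberRoots_le (P : Polynomial (Polynomial ℂ)) (z : ℂ) :
    (fiberRoots P z).card ≤ P.natDegree :=
  ((Multiset.toFinset_card_le _).trans (Polynomial.card_roots' _)).trans
    Polynomial.natDegree_map_le

theorem card_fiberRoots_eq (P : Polynomial (Polynomial ℂ)) {z : ℂ}
    (hl : P.leadingCoeff.eval z ≠ 0)
    (hs : ∀ w, P.evalEval z w = 0 → P.derivative.evalEval z w ≠ 0) :
    (fiberRoots P z).card = P.natDegree := by
  have hl' : Polynomial.evalRingHom z P.leadingCoeff ≠ 0 := hl
  have hne : P.map (Polynomial.evalRingHom z) ≠ 0 := fun h => hl' <| by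
    have := congrArg (fun p => p.coeff P.natDegree) h
    simpa using this
  have hnd : (P.map (Polynomial.evalRingHom z)).roots.Nodup := by
    refine Multiset.nodup_iff_count_le_one.2 fun w => ?_
    rw [Polynomial.count_roots]
    by_contra! h
    obtain ⟨h1, h2⟩ := (Polynomial.one_lt_rootMultiplicity_iff_isRoot hne).1 h
    rw [Polynomial.derivative_map, Polynomial.IsRoot, Polynomial.map_evalRingHom_eval] at h2
    rw [Polynomial.IsRoot, Polynomial.map_evalRingHom_eval] at h1
    exact hs w h1 h2
  rw [fiberRoots, Multiset.toFinset_card_of_nodup hnd, IsAlgClosed.card_roots_eq_natDegree,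
    Polynomial.natDegree_map_of_leadingCoeff_ne_zero _ hl']

open Classical in
/-- The roots of `P(z, ·)` lying in a given subset of the plane. -/
noncomputable def fiberRootsIn (P : Polynomial (Polynomial ℂ)) (A : Set (ℂ × ℂ)) (z : ℂ) :
    Finset ℂ :=
  (fiberRoots P z).filter fun w => (z, w) ∈ A

theorem mem_fiberRootsIn {P : Polynomial (Polynomial ℂ)} {A : Set (ℂ × ℂ)} {z w : ℂ}
    (hv : P.map (Polynomial.evalRingHom z) ≠ 0) :
    w ∈ fiberRootsIn P A z ↔ P.evalEval z w = 0 ∧ (z, w) ∈ A := by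
  simp [fiberRootsIn, mem_fiberRoots hv]

open Classical in
/-- Over a point `z₀` where `P(z₀, ·)` has full degree and simple roots, the roots lying in either
piece of a separation of the zero set are given by finitely many differentiable functions. -/
theorem exists_local_fiberRootsIn (P : Polynomial (Polynomial ℂ)) {A B : Set (ℂ × ℂ)}
    (hA : IsClosed A) (hB : IsClosed B) (hAB : Disjoint A B)
    (hcov : ∀ z w, P.evalEval z w = 0 → (z, w) ∈ A ∪ B)
    (hv : ∀ z, P.map (Polynomial.evalRingHom z) ≠ 0) {z₀ : ℂ}
    (hl : P.leadingCoeff.eval z₀ ≠ 0)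
    (hs : ∀ w, P.evalEval z₀ w = 0 → P.derivative.evalEval z₀ w ≠ 0) :
    ∃ φ : ℂ → ℂ → ℂ, (∀ w ∈ fiberRoots P z₀, φ w z₀ = w ∧ DifferentiableAt ℂ (φ w) z₀) ∧
      ∀ᶠ z in 𝓝 z₀, Set.InjOn (fun w => φ w z) (fiberRoots P z₀) ∧
        fiberRootsIn P A z = (fiberRootsIn P A z₀).image (fun w => φ w z) ∧
        fiberRootsIn P B z = (fiberRootsIn P B z₀).image (fun w => φ w z) := by
  have hex : ∀ w, ∃ φ : ℂ → ℂ, w ∈ fiberRoots P z₀ → φ z₀ = w ∧ DifferentiableAt ℂ φ z₀ ∧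
      ∀ᶠ z in 𝓝 z₀, P.evalEval z (φ z) = 0 := by
    intro w
    by_cases hw : w ∈ fiberRoots P z₀
    · have h0 := (mem_fiberRoots (hv z₀)).1 hw
      obtain ⟨φ, hφ⟩ := exists_local_root P h0 (hs w h0)
      exact ⟨φ, fun _ => hφ⟩
    · exact ⟨0, fun h => absurd h hw⟩
  choose φ hφ using hex
  refine ⟨φ, fun w hw => ⟨(hφ w hw).1, (hφ w hw).2.1⟩, ?_⟩
  have htend : ∀ w ∈ fiberRoots P z₀, Tendsto (φ w) (𝓝 z₀) (𝓝 w) := fun w hw => by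
    have := (hφ w hw).2.1.continuousAt.tendsto
    rwa [(hφ w hw).1] at this
  have htend' : ∀ w ∈ fiberRoots P z₀, Tendsto (fun z => (z, φ w z)) (𝓝 z₀) (𝓝 (z₀, w)) :=
    fun w hw => tendsto_id.prodMk_nhds (htend w hw)
  have hroot : ∀ᶠ z in 𝓝 z₀, ∀ w ∈ fiberRoots P z₀, P.evalEval z (φ w z) = 0 :=
    (Finset.eventually_all _).2 fun w hw => (hφ w hw).2.2
  have hinj : ∀ᶠ z in 𝓝 z₀, ∀ w ∈ fiberRoots P z₀, ∀ w' ∈ fiberRoots P z₀,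
      w ≠ w' → φ w z ≠ φ w' z := by
    refine (Finset.eventually_all _).2 fun w hw => (Finset.eventually_all _).2 fun w' hw' => ?_
    by_cases h : w = w'
    · exact Eventually.of_forall fun _ h' => absurd h h'
    · filter_upwards [((htend w hw).sub (htend w' hw')).eventually_ne (sub_ne_zero.2 h)]
        with z hz _ using sub_ne_zero.1 hz
  have hpart : ∀ {A B : Set (ℂ × ℂ)}, IsClosed B → Disjoint A B →
      (∀ z w, P.evalEval z w = 0 → (z, w) ∈ A ∪ B) →
      ∀ᶠ z in 𝓝 z₀, ∀ w ∈ fiberRoots P z₀, (z₀, w) ∈ A → (z, φ w z) ∈ A := by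
    intro A B hB hAB hcov
    refine (Finset.eventually_all _).2 fun w hw => ?_
    by_cases h : (z₀, w) ∈ A
    · have h1 := (htend' w hw).eventually (hB.isOpen_compl.mem_nhds fun h' =>
        Set.disjoint_left.1 hAB h h')
      filter_upwards [h1, (hφ w hw).2.2] with z hz hz0 _
      exact (hcov z _ hz0).resolve_right hz
    · exact Eventually.of_forall fun _ h' => absurd h' h
  filter_upwards [hroot, hinj, hpart hB hAB hcov,
    hpart hA hAB.symm fun z w h => (hcov z w h).symm] with z hz0 hzinj hzA hzB
  have hinjOn : Set.InjOn (fun w => φ w z) (fiberRoots P z₀) := fun w hw w' hw' h => by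
    by_contra hne
    exact hzinj w hw w' hw' hne h
  have himg : (fiberRoots P z₀).image (fun w => φ w z) = fiberRoots P z := by
    refine Finset.eq_of_subset_of_card_le ?_ ?_
    · intro x hx
      obtain ⟨w, hw, rfl⟩ := Finset.mem_image.1 hx
      exact (mem_fiberRoots (hv z)).2 (hz0 w hw)
    · rw [Finset.card_image_of_injOn hinjOn, card_fiberRoots_eq P hl hs]
      exact card_fiberRoots_le P z
  have hfil : ∀ {A B : Set (ℂ × ℂ)}, Disjoint A B →
      (∀ z w, P.evalEval z w = 0 → (z, w) ∈ A ∪ B) →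
      (∀ w ∈ fiberRoots P z₀, (z₀, w) ∈ A → (z, φ w z) ∈ A) →
      (∀ w ∈ fiberRoots P z₀, (z₀, w) ∈ B → (z, φ w z) ∈ B) →
      fiberRootsIn P A z = (fiberRootsIn P A z₀).image (fun w => φ w z) := by
    intro A B hAB hcov hzA hzB
    ext x
    simp only [fiberRootsIn, Finset.mem_filter, Finset.mem_image]
    rw [← himg, Finset.mem_image]
    constructor
    · rintro ⟨⟨w, hw, rfl⟩, hx⟩
      refine ⟨w, ⟨hw, ?_⟩, rfl⟩
      refine (hcov z₀ w ((mem_fiberRoots (hv z₀)).1 hw)).resolve_right fun h => ?_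
      exact Set.disjoint_left.1 hAB hx (hzB w hw h)
    · rintro ⟨w, ⟨hw, hwA⟩, rfl⟩
      exact ⟨⟨w, hw, rfl⟩, hzA w hw hwA⟩
  exact ⟨hinjOn, hfil hAB hcov hzA hzB,
    hfil hAB.symm (fun z w h => (hcov z w h).symm) hzB hzA⟩

/-- The reciprocal of the product of all differences between roots of `P(z, ·)` in `A` and roots
in `B`. -/
noncomputable def invDiffProd (P : Polynomial (Polynomial ℂ)) (A B : Set (ℂ × ℂ)) (z : ℂ) : ℂ :=
  ∏ w ∈ fiberRootsIn P A z, ∏ w' ∈ fiberRootsIn P B z, (w - w')⁻¹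

theorem ne_of_mem_fiberRootsIn {P : Polynomial (Polynomial ℂ)} {A B : Set (ℂ × ℂ)}
    (hAB : Disjoint A B) {z w w' : ℂ} (hw : w ∈ fiberRootsIn P A z)
    (hw' : w' ∈ fiberRootsIn P B z) : w ≠ w' := by
  classical
  rintro rfl
  exact Set.disjoint_left.1 hAB (Finset.mem_filter.1 hw).2 (Finset.mem_filter.1 hw').2

theorem invDiffProd_ne_zero {P : Polynomial (Polynomial ℂ)} {A B : Set (ℂ × ℂ)}
    (hAB : Disjoint A B) (z : ℂ) : invDiffProd P A B z ≠ 0 :=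
  Finset.prod_ne_zero_iff.2 fun _ hw => Finset.prod_ne_zero_iff.2 fun _ hw' =>
    inv_ne_zero (sub_ne_zero.2 (ne_of_mem_fiberRootsIn hAB hw hw'))

theorem differentiableAt_invDiffProd (P : Polynomial (Polynomial ℂ)) {A B : Set (ℂ × ℂ)}
    (hA : IsClosed A) (hB : IsClosed B) (hAB : Disjoint A B)
    (hcov : ∀ z w, P.evalEval z w = 0 → (z, w) ∈ A ∪ B)
    (hv : ∀ z, P.map (Polynomial.evalRingHom z) ≠ 0) {z₀ : ℂ}
    (hl : P.leadingCoeff.eval z₀ ≠ 0)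
    (hs : ∀ w, P.evalEval z₀ w = 0 → P.derivative.evalEval z₀ w ≠ 0) :
    DifferentiableAt ℂ (invDiffProd P A B) z₀ := by
  classical
  obtain ⟨φ, hφ, hev⟩ := exists_local_fiberRootsIn P hA hB hAB hcov hv hl hs
  have hsub : ∀ A, fiberRootsIn P A z₀ ⊆ fiberRoots P z₀ := fun A => Finset.filter_subset _ _
  have heq : invDiffProd P A B =ᶠ[𝓝 z₀] fun z =>
      ∏ w ∈ fiberRootsIn P A z₀, ∏ w' ∈ fiberRootsIn P B z₀, (φ w z - φ w' z)⁻¹ := by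
    filter_upwards [hev] with z ⟨hinj, h1, h2⟩
    rw [invDiffProd, h1, h2, Finset.prod_image (hinj.mono (hsub A))]
    refine Finset.prod_congr rfl fun w _ => ?_
    rw [Finset.prod_image (hinj.mono (hsub B))]
  refine DifferentiableAt.congr_of_eventuallyEq ?_ heq
  refine DifferentiableAt.fun_finsetProd fun w hw => DifferentiableAt.fun_finsetProd fun w' hw' => ?_
  refine ((hφ w (hsub A hw)).2.sub (hφ w' (hsub B hw')).2).inv ?_
  rw [Pi.sub_apply, (hφ w (hsub A hw)).1, (hφ w' (hsub B hw')).1]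
  exact sub_ne_zero.2 (ne_of_mem_fiberRootsIn hAB hw hw')

theorem norm_invDiffProd_le (P : Polynomial (Polynomial ℂ)) {A B : Set (ℂ × ℂ)} {δ : ℝ}
    (hδ : 0 < δ) (hδ1 : δ ≤ 1) {z : ℂ}
    (hsep : ∀ w ∈ fiberRootsIn P A z, ∀ w' ∈ fiberRootsIn P B z, δ ≤ ‖w - w'‖) :
    ‖invDiffProd P A B z‖ ≤ (δ⁻¹) ^ (P.natDegree * P.natDegree) ∧
    ∀ w ∈ fiberRootsIn P A z, ∀ w' ∈ fiberRootsIn P B z,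
      ‖invDiffProd P A B z‖ ≤ ‖w - w'‖⁻¹ * (δ⁻¹) ^ (P.natDegree * P.natDegree) := by
  classical
  have h1 : 1 ≤ δ⁻¹ := (one_le_inv₀ hδ).2 hδ1
  have hcard : (fiberRootsIn P A z ×ˢ fiberRootsIn P B z).card ≤ P.natDegree * P.natDegree := by
    rw [Finset.card_product]
    exact Nat.mul_le_mul
      ((Finset.card_le_card (Finset.filter_subset _ _)).trans (card_fiberRoots_le P z))
      ((Finset.card_le_card (Finset.filter_subset _ _)).trans (card_fiberRoots_le P z))
  have hform : ‖invDiffProd P A B z‖ =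
      ∏ p ∈ fiberRootsIn P A z ×ˢ fiberRootsIn P B z, ‖p.1 - p.2‖⁻¹ := by
    rw [invDiffProd, ← Finset.prod_product', norm_prod]
    simp
  have hfac : ∀ s ⊆ fiberRootsIn P A z ×ˢ fiberRootsIn P B z,
      ∏ p ∈ s, ‖p.1 - p.2‖⁻¹ ≤ (δ⁻¹) ^ (P.natDegree * P.natDegree) := by
    intro s hs
    refine (Finset.prod_le_prod (g := fun _ => δ⁻¹) (fun p _ => by positivity) fun p hp => ?_).trans
      ((Finset.prod_const _).trans_le
        (pow_le_pow_right₀ h1 ((Finset.card_le_card hs).trans hcard)))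
    obtain ⟨ha, hb⟩ := Finset.mem_product.1 (hs hp)
    exact inv_anti₀ hδ (hsep _ ha _ hb)
  refine ⟨hform ▸ hfac _ subset_rfl, fun w hw w' hw' => ?_⟩
  rw [hform, ← Finset.mul_prod_erase _ _ (Finset.mk_mem_product hw hw')]
  exact mul_le_mul_of_nonneg_left (hfac _ (Finset.erase_subset _ _)) (by positivity)

/-- Two disjoint closed pieces of the zero set of `P` are uniformly separated along the fibers of
the first projection, provided distinct points of a fiber are separated near infinity. -/
theorem exists_fiber_separation (P : Polynomial (Polynomial ℂ)) {A B : Set (ℂ × ℂ)}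
    (hA : IsClosed A) (hB : IsClosed B) (hAB : Disjoint A B)
    (hfar : ∀ K : ℝ, ∃ R : ℝ, ∀ z w w', P.evalEval z w = 0 → P.evalEval z w' = 0 → w ≠ w' →
      R ≤ ‖w‖ → K ≤ ‖w - w'‖)
    (hinf : ∃ R δ : ℝ, 0 < δ ∧ ∀ z w w', P.evalEval z w = 0 → P.evalEval z w' = 0 → w ≠ w' →
      R ≤ ‖z‖ → δ ≤ ‖w - w'‖) :
    ∃ δ : ℝ, 0 < δ ∧ δ ≤ 1 ∧ ∀ z w w', P.evalEval z w = 0 → P.evalEval z w' = 0 →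
      (z, w) ∈ A → (z, w') ∈ B → δ ≤ ‖w - w'‖ := by
  obtain ⟨R₁, hR₁⟩ := hfar 1
  obtain ⟨R₂, δ₂, hδ₂, hR₂⟩ := hinf
  set K : Set (ℂ × ℂ) := A ∩ Metric.closedBall 0 (max R₁ R₂)
  have hK : IsCompact K := (isCompact_closedBall _ _).inter_left hA
  obtain ⟨r, hr, hrAB⟩ := Metric.exists_pos_forall_lt_edist hK hB
    (hAB.mono_left Set.inter_subset_left)
  refine ⟨min 1 (min δ₂ r), by positivity, min_le_left _ _, fun z w w' h0 h0' hwA hwB => ?_⟩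
  have hne : w ≠ w' := by
    rintro rfl
    exact Set.disjoint_left.1 hAB hwA hwB
  by_cases h1 : R₁ ≤ ‖w‖
  · exact (min_le_left _ _).trans (hR₁ z w w' h0 h0' hne h1)
  by_cases h2 : R₂ ≤ ‖z‖
  · exact (min_le_right _ _).trans ((min_le_left _ _).trans (hR₂ z w w' h0 h0' hne h2))
  have hwK : (z, w) ∈ K := by
    refine ⟨hwA, ?_⟩
    rw [mem_closedBall_zero_iff, Prod.norm_def]
    push Not at h1 h2
    exact max_le (h2.le.trans (le_max_right _ _)) (h1.le.trans (le_max_left _ _))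
  have h3 := hrAB _ hwK _ hwB
  have h4 : edist (z, w) (z, w') = ENNReal.ofReal ‖w - w'‖ := by
    rw [Prod.edist_eq, edist_self, edist_dist, dist_eq_norm]
    simp
  rw [h4, ← ENNReal.ofReal_coe_nnreal] at h3
  exact (min_le_right _ _).trans ((min_le_right _ _).trans
    ((ENNReal.ofReal_lt_ofReal_iff_of_nonneg r.coe_nonneg).1 h3).le)

/-- If a closed piece of a separation of the zero set of `P` is nonempty then it meets the fiber over
every point where `P(z, ·)` has full degree and simple roots. -/
theorem fiberRootsIn_nonempty (P : Polynomial (Polynomial ℂ)) {A B : Set (ℂ × ℂ)}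
    (hA : IsClosed A) (hB : IsClosed B) (hAB : Disjoint A B)
    (hcov : ∀ z w, P.evalEval z w = 0 → (z, w) ∈ A ∪ B)
    (hv : ∀ z, P.map (Polynomial.evalRingHom z) ≠ 0) {S : Set ℂ} (hS : S.Finite)
    (hl : ∀ z ∉ S, P.leadingCoeff.eval z ≠ 0)
    (hs : ∀ z ∉ S, ∀ w, P.evalEval z w = 0 → P.derivative.evalEval z w ≠ 0)
    {a : ℂ × ℂ} (ha : P.evalEval a.1 a.2 = 0) (haA : a ∈ A) {z : ℂ} (hz : z ∉ S) :
    (fiberRootsIn P A z).Nonempty := by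
  classical
  have hpre : IsPreconnected Sᶜ :=
    (hS.countable.isPathConnected_compl_of_one_lt_rank
      (Complex.rank_real_complex ▸ Cardinal.one_lt_two)).isConnected.isPreconnected
  have hloc : ∀ z₀ ∉ S, ∀ᶠ z in 𝓝 z₀,
      ((fiberRootsIn P A z).Nonempty ↔ (fiberRootsIn P A z₀).Nonempty) := by
    intro z₀ hz₀
    obtain ⟨φ, -, hev⟩ := exists_local_fiberRootsIn P hA hB hAB hcov hv (hl z₀ hz₀) (hs z₀ hz₀)
    filter_upwards [hev] with z hz
    rw [hz.2.1, Finset.image_nonempty]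
  obtain ⟨z₁, hz₁S, hz₁⟩ : ∃ z₁ ∉ S, (fiberRootsIn P A z₁).Nonempty := by
    have hBn : ∀ᶠ p in 𝓝 (a.1, a.2), p ∉ B :=
      hB.isOpen_compl.mem_nhds fun h => Set.disjoint_left.1 hAB haA h
    rw [nhds_prod_eq] at hBn
    obtain ⟨U, hU, V, hV, hUV⟩ := Filter.mem_prod_iff.1 hBn
    have h1 : ∀ᶠ z in 𝓝[≠] a.1, ∃ w ∈ V, P.evalEval z w = 0 :=
      (eventually_exists_root_near P ha (hv a.1) hV).filter_mono nhdsWithin_le_nhds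
    have h2 : ∀ᶠ z in 𝓝[≠] a.1, z ∉ S := by
      have := (hS.subset (Set.sdiff_subset (t := {a.1}))).isClosed.isOpen_compl.mem_nhds
        (x := a.1) (by simp)
      filter_upwards [mem_nhdsWithin_of_mem_nhds this, self_mem_nhdsWithin] with z hz hne h
      exact hz ⟨h, hne⟩
    obtain ⟨z, ⟨w, hw, h0⟩, hzS, hzU⟩ :=
      (h1.and (h2.and (mem_nhdsWithin_of_mem_nhds hU))).exists
    refine ⟨z, hzS, w, (mem_fiberRootsIn (hv z)).2 ⟨h0, ?_⟩⟩
    exact (hcov z w h0).resolve_right (hUV (Set.mk_mem_prod hzU hw))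
  by_contra hno
  have hpre' := hpre {z | ∀ᶠ y in 𝓝 z, (fiberRootsIn P A y).Nonempty}
    {z | ∀ᶠ y in 𝓝 z, ¬ (fiberRootsIn P A y).Nonempty}
    isOpen_setOfPred_eventually_nhds isOpen_setOfPred_eventually_nhds ?_ ⟨z₁, hz₁S, ?_⟩ ⟨z, hz, ?_⟩
  · obtain ⟨y, -, hy1, hy2⟩ := hpre'
    exact hy2.self_of_nhds hy1.self_of_nhds
  · intro y hy
    by_cases h : (fiberRootsIn P A y).Nonempty
    · exact Or.inl ((hloc y hy).mono fun x hx => hx.2 h)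
    · exact Or.inr ((hloc y hy).mono fun x hx => fun h' => h (hx.1 h'))
  · exact (hloc z₁ hz₁S).mono fun x hx => hx.2 hz₁
  · exact (hloc z hz).mono fun x hx => fun hmem => hno (hx.1 hmem)

/-- A criterion for the zero set of `P` to be connected: over almost every `z` the roots of
`P(z, ·)` are simple, distinct roots over the same `z` are far from each other when one of them is
large, stay apart when `z` is large, and the second coordinate takes almost all values. -/
theorem isPreconnected_zeroLocus (P : Polynomial (Polynomial ℂ))
    (hv : ∀ z, P.map (Polynomial.evalRingHom z) ≠ 0)
    (hs : ∃ c : Polynomial ℂ, c ≠ 0 ∧ ∀ z, c.eval z ≠ 0 → ∀ w, P.evalEval z w = 0 →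
      P.derivative.evalEval z w ≠ 0)
    (hfar : ∀ K : ℝ, ∃ R : ℝ, ∀ z w w', P.evalEval z w = 0 → P.evalEval z w' = 0 → w ≠ w' →
      R ≤ ‖w‖ → K ≤ ‖w - w'‖)
    (hinf : ∃ R δ : ℝ, 0 < δ ∧ ∀ z w w', P.evalEval z w = 0 → P.evalEval z w' = 0 → w ≠ w' →
      R ≤ ‖z‖ → δ ≤ ‖w - w'‖)
    (hesc : ∃ q : Polynomial ℂ, q ≠ 0 ∧ ∀ w, q.eval w ≠ 0 → ∃ z, P.evalEval z w = 0) :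
    IsPreconnected {p : ℂ × ℂ | P.evalEval p.1 p.2 = 0} := by
  have hcl : IsClosed {p : ℂ × ℂ | P.evalEval p.1 p.2 = 0} :=
    isClosed_eq (contDiff_evalEval P 0).continuous continuous_const
  rw [isPreconnected_iff_subset_of_fully_disjoint_closed hcl]
  intro A B hA hB hsub hAB
  by_contra! hcon
  obtain ⟨hnA, hnB⟩ := hcon
  obtain ⟨b, hb0, hbA⟩ := Set.not_subset.1 hnA
  obtain ⟨a, ha0, haB⟩ := Set.not_subset.1 hnB
  have hbB : b ∈ B := (hsub hb0).resolve_left hbA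
  have haA : a ∈ A := (hsub ha0).resolve_right haB
  have hcov : ∀ z w, P.evalEval z w = 0 → (z, w) ∈ A ∪ B := fun z w h => hsub h
  obtain ⟨δ, hδ, hδ1, hsep⟩ := exists_fiber_separation P hA hB hAB hfar hinf
  obtain ⟨c, hc, hcs⟩ := hs
  obtain ⟨q, hq, hqz⟩ := hesc
  have hP : P ≠ 0 := fun h => hv 0 (by simp [h])
  set S : Set ℂ := {z | (c * P.leadingCoeff).IsRoot z}
  have hS : S.Finite := Polynomial.finite_setOfPred_isRoot
    (mul_ne_zero hc (Polynomial.leadingCoeff_ne_zero.2 hP))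
  have hgood : ∀ z ∉ S, c.eval z ≠ 0 ∧ P.leadingCoeff.eval z ≠ 0 := fun z hz => by
    have : ¬ (c * P.leadingCoeff).IsRoot z := hz
    rwa [Polynomial.IsRoot, Polynomial.eval_mul, mul_eq_zero, not_or] at this
  have hl : ∀ z ∉ S, P.leadingCoeff.eval z ≠ 0 := fun z hz => (hgood z hz).2
  have hsr : ∀ z ∉ S, ∀ w, P.evalEval z w = 0 → P.derivative.evalEval z w ≠ 0 :=
    fun z hz => hcs z (hgood z hz).1
  have hsep' : ∀ z, ∀ w ∈ fiberRootsIn P A z, ∀ w' ∈ fiberRootsIn P B z, δ ≤ ‖w - w'‖ := by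
    intro z w hw w' hw'
    obtain ⟨h1, h2⟩ := (mem_fiberRootsIn (hv z)).1 hw
    obtain ⟨h3, h4⟩ := (mem_fiberRootsIn (hv z)).1 hw'
    exact hsep z w w' h1 h3 h2 h4
  set M := (δ⁻¹) ^ (P.natDegree * P.natDegree)
  have hM : 0 < M := by positivity
  obtain ⟨e, he⟩ := exists_const_of_bounded_off_finite hS (invDiffProd P A B) M
    (fun z hz => differentiableAt_invDiffProd P hA hB hAB hcov hv (hl z hz) (hsr z hz))
    (fun z _ => (norm_invDiffProd_le P hδ hδ1 (hsep' z)).1)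
  have hlarge : ∀ R : ℝ, ∃ z ∉ S, ∃ w, P.evalEval z w = 0 ∧ R ≤ ‖w‖ := by
    intro R
    have hfin : ({w | q.IsRoot w} ∪ ⋃ z ∈ S, (fiberRoots P z : Set ℂ)).Finite :=
      (Polynomial.finite_setOfPred_isRoot hq).union
        (hS.biUnion fun z _ => Finset.finite_toSet _)
    obtain ⟨w, hwR, hw⟩ : ∃ w : ℂ, R ≤ ‖w‖ ∧
        w ∉ ({w | q.IsRoot w} ∪ ⋃ z ∈ S, (fiberRoots P z : Set ℂ)) := by
      obtain ⟨C, hC⟩ := isBounded_iff_forall_norm_le.1 hfin.isBounded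
      refine ⟨((|R| + |C| + 1 : ℝ) : ℂ), ?_, fun h => ?_⟩
      · rw [Complex.norm_real, Real.norm_of_nonneg (by positivity)]
        linarith [le_abs_self R, abs_nonneg C]
      · have := hC _ h
        rw [Complex.norm_real, Real.norm_of_nonneg (by positivity)] at this
        linarith [le_abs_self C, abs_nonneg R]
    rw [Set.mem_union, not_or] at hw
    obtain ⟨z, hz⟩ := hqz w hw.1
    refine ⟨z, fun hzS => hw.2 ?_, w, hz, hwR⟩
    exact Set.mem_biUnion hzS (Finset.mem_coe.2 ((mem_fiberRoots (hv z)).2 hz))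
  have hbound : ∀ K : ℝ, 0 < K → ‖e‖ ≤ K⁻¹ * M := by
    intro K hK
    obtain ⟨R, hR⟩ := hfar K
    obtain ⟨z, hzS, w, h0, hwR⟩ := hlarge R
    rw [← he z hzS]
    have hne := (norm_invDiffProd_le P hδ hδ1 (hsep' z)).2
    rcases hcov z w h0 with h | h
    · obtain ⟨w', hw'⟩ := fiberRootsIn_nonempty P hB hA hAB.symm
        (fun z w h => (hcov z w h).symm) hv hS hl hsr hb0 hbB hzS
      have hw : w ∈ fiberRootsIn P A z := (mem_fiberRootsIn (hv z)).2 ⟨h0, h⟩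
      refine (hne w hw w' hw').trans (mul_le_mul_of_nonneg_right (inv_anti₀ hK ?_) hM.le)
      exact hR z w w' h0 ((mem_fiberRootsIn (hv z)).1 hw').1
        (ne_of_mem_fiberRootsIn hAB hw hw') hwR
    · obtain ⟨w', hw'⟩ := fiberRootsIn_nonempty P hA hB hAB hcov hv hS hl hsr ha0 haA hzS
      have hw : w ∈ fiberRootsIn P B z := (mem_fiberRootsIn (hv z)).2 ⟨h0, h⟩
      refine (hne w' hw' w hw).trans (mul_le_mul_of_nonneg_right (inv_anti₀ hK ?_) hM.le)
      rw [norm_sub_rev]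
      exact hR z w w' h0 ((mem_fiberRootsIn (hv z)).1 hw').1
        (ne_of_mem_fiberRootsIn hAB hw' hw).symm hwR
  obtain ⟨z, hzS, -⟩ := hlarge 0
  have hepos : 0 < ‖e‖ := norm_pos_iff.2 (he z hzS ▸ invDiffProd_ne_zero hAB z)
  have := hbound (2 * M / ‖e‖) (by positivity)
  rw [inv_div, div_mul_eq_mul_div, le_div_iff₀ (by positivity)] at this
  nlinarith [mul_pos hepos hM]

/-- Clearing the denominators of a polynomial over the fraction field. -/
theorem exists_map_eq_C_mul (p : Polynomial (RatFunc ℂ)) :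
    ∃ (b : Polynomial ℂ) (q : Polynomial (Polynomial ℂ)), b ≠ 0 ∧
      q.map (algebraMap (Polynomial ℂ) (RatFunc ℂ)) =
        Polynomial.C (algebraMap (Polynomial ℂ) (RatFunc ℂ) b) * p := by
  obtain ⟨b, hb, h⟩ := IsLocalization.integerNormalization_spec
    (nonZeroDivisors (Polynomial ℂ)) p
  refine ⟨b, _, nonZeroDivisors.ne_zero hb, h.trans ?_⟩
  rw [← Polynomial.smul_eq_C_mul, algebraMap_smul]

/-- A bivariate polynomial with singular zeros in almost every fiber of the first projection has a
multiple factor, after clearing denominators. -/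
theorem exists_simple_roots_of_squarefree (P : Polynomial (Polynomial ℂ)) (hP : P ≠ 0)
    (hsq : ∀ (b : Polynomial ℂ) (G H : Polynomial (Polynomial ℂ)), b ≠ 0 →
      Polynomial.C b * P = G * G * H → G.natDegree = 0) :
    ∃ c : Polynomial ℂ, c ≠ 0 ∧ ∀ z, c.eval z ≠ 0 → ∀ w, P.evalEval z w = 0 →
      P.derivative.evalEval z w ≠ 0 := by
  set ι := algebraMap (Polynomial ℂ) (RatFunc ℂ)
  have hι : Function.Injective ι := IsFractionRing.injective (Polynomial ℂ) (RatFunc ℂ)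
  have hιm : Function.Injective (Polynomial.map ι) := Polynomial.map_injective ι hι
  have : CharZero (RatFunc ℂ) := charZero_of_injective_algebraMap
    (algebraMap ℂ (RatFunc ℂ)).injective
  have hsqf : Squarefree (P.map ι) := by
    rintro x ⟨y, hxy⟩
    obtain ⟨b, G, hb, hG⟩ := exists_map_eq_C_mul x
    obtain ⟨b', H, hb', hH⟩ := exists_map_eq_C_mul y
    have hx : x ≠ 0 := by
      rintro rfl
      rw [zero_mul, zero_mul, Polynomial.map_eq_zero_iff hι] at hxy
      exact hP hxy
    have hdeg := hsq (b * b * b') G H (mul_ne_zero (mul_ne_zero hb hb) hb') <| hιm <| by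
      simp only [Polynomial.map_mul, Polynomial.map_C, map_mul]
      change _ = Polynomial.map (algebraMap _ _) G * Polynomial.map (algebraMap _ _) G *
        Polynomial.map (algebraMap _ _) H
      rw [hxy, hG, hH]
      ring
    have hxd : x.natDegree = 0 := by
      rw [← Polynomial.natDegree_C_mul (a := ι b) (fun h => hb (hι (h.trans (map_zero ι).symm))),
        ← hG, Polynomial.natDegree_map_eq_of_injective hι, hdeg]
    rw [Polynomial.isUnit_iff_degree_eq_zero, Polynomial.degree_eq_natDegree hx, hxd]
    rfl
  obtain ⟨u, v, huv⟩ := PerfectField.separable_iff_squarefree.2 hsqf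
  obtain ⟨b, U, hb, hU⟩ := exists_map_eq_C_mul u
  obtain ⟨b', V, hb', hV⟩ := exists_map_eq_C_mul v
  have key : Polynomial.C b' * U * P + Polynomial.C b * V * P.derivative =
      Polynomial.C (b * b') := hιm <| by
    simp only [Polynomial.map_add, Polynomial.map_mul, Polynomial.map_C, map_mul,
      ← Polynomial.derivative_map]
    change Polynomial.C (ι b') * Polynomial.map (algebraMap _ _) U * _ +
      Polynomial.C (ι b) * Polynomial.map (algebraMap _ _) V * _ = _
    rw [hU, hV]
    linear_combination (Polynomial.C (ι b) * Polynomial.C (ι b')) * huv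
  refine ⟨b * b', mul_ne_zero hb hb', fun z hz w h0 h1 => hz ?_⟩
  have := congrArg (Polynomial.evalEval z w) key
  simp only [Polynomial.evalEval_add, Polynomial.evalEval_mul, h0, h1, Polynomial.evalEval_C,
    mul_zero, add_zero] at this
  exact this.symm

/-- A polynomial `f ∈ ℂ[z,w]` as a polynomial in `w` with coefficients in `ℂ[z]`. -/
noncomputable def toBivariate : MvPolynomial (Fin 2) ℂ →ₐ[ℂ] Polynomial (Polynomial ℂ) :=
  MvPolynomial.aeval ![Polynomial.C Polynomial.X, Polynomial.X]

/-- A polynomial in `w` with coefficients in `ℂ[z]` as an element of `ℂ[z,w]`. -/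
noncomputable def ofBivariate : Polynomial (Polynomial ℂ) →+* MvPolynomial (Fin 2) ℂ :=
  Polynomial.eval₂RingHom (Polynomial.aeval (MvPolynomial.X 0 : MvPolynomial (Fin 2) ℂ)).toRingHom
    (MvPolynomial.X 1)

theorem ofBivariate_toBivariate (f : MvPolynomial (Fin 2) ℂ) :
    ofBivariate (toBivariate f) = f := by
  have : ofBivariate.comp (toBivariate : MvPolynomial (Fin 2) ℂ →+* _) = RingHom.id _ := by
    refine MvPolynomial.ringHom_ext (fun r => ?_) fun i => ?_
    · simp [ofBivariate, toBivariate, MvPolynomial.algebraMap_eq]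
    · fin_cases i <;> simp [ofBivariate, toBivariate]
  exact congrArg (fun φ => φ f) this

theorem eval_ofBivariate (Q : Polynomial (Polynomial ℂ)) (z w : ℂ) :
    MvPolynomial.eval ![z, w] (ofBivariate Q) = Q.evalEval z w := by
  have : (MvPolynomial.eval ![z, w]).comp ofBivariate = Polynomial.evalEvalRingHom z w := by
    refine Polynomial.ringHom_ext (fun a => ?_) ?_
    · have : ((MvPolynomial.eval ![z, w]).comp ofBivariate).comp Polynomial.C =
        (Polynomial.evalEvalRingHom z w).comp Polynomial.C := by
        refine Polynomial.ringHom_ext (fun a => ?_) ?_ <;>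
          simp [ofBivariate, MvPolynomial.algebraMap_eq]
      exact congrArg (fun φ => φ a) this
    · simp [ofBivariate]
  exact congrArg (fun φ => φ Q) this

theorem evalEval_toBivariate (f : MvPolynomial (Fin 2) ℂ) (z w : ℂ) :
    (toBivariate f).evalEval z w = MvPolynomial.eval ![z, w] f := by
  rw [← eval_ofBivariate, ofBivariate_toBivariate]

theorem toBivariate_eq_sum (f : MvPolynomial (Fin 2) ℂ) :
    toBivariate f = ∑ d ∈ f.support, Polynomial.C
      (Polynomial.C (MvPolynomial.coeff d f) * Polynomial.X ^ d 0) * Polynomial.X ^ d 1 := by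
  rw [toBivariate, MvPolynomial.aeval_def, MvPolynomial.eval₂_eq']
  refine Finset.sum_congr rfl fun d _ => ?_
  simp [Fin.prod_univ_two, mul_assoc]

theorem coeff_toBivariate (f : MvPolynomial (Fin 2) ℂ) (j : ℕ) :
    (toBivariate f).coeff j = ∑ d ∈ f.support with d 1 = j,
      Polynomial.C (MvPolynomial.coeff d f) * Polynomial.X ^ d 0 := by
  rw [toBivariate_eq_sum, Polynomial.finsetSum_coeff, Finset.sum_filter]
  refine Finset.sum_congr rfl fun d _ => ?_
  rw [Polynomial.coeff_C_mul_X_pow]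
  simp only [eq_comm]

end PlaneCurve

section NewtonPolygon

variable {f : MvPolynomial (Fin 2) ℂ}

theorem mem_newtonPolygon_of_mem_support {d : Fin 2 →₀ ℕ} (hd : d ∈ f.support) :
    ((d 0 : ℝ), (d 1 : ℝ)) ∈ newtonPolygon f :=
  subset_convexHull ℝ _ ⟨d, hd, rfl⟩

theorem linear_le_on_newtonPolygon {x y N : ℝ}
    (hle : ∀ d ∈ f.support, x * (d 0 : ℝ) + y * (d 1 : ℝ) ≤ N) {p : ℝ × ℝ}
    (hp : p ∈ newtonPolygon f) : x * p.1 + y * p.2 ≤ N := by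
  have hconv : Convex ℝ {p : ℝ × ℝ | x * p.1 + y * p.2 ≤ N} :=
    convex_halfSpace_le (f := fun p : ℝ × ℝ => x * p.1 + y * p.2)
      ⟨fun p q => by simp only [Prod.fst_add, Prod.snd_add]; ring,
        fun c p => by simp only [Prod.smul_fst, Prod.smul_snd, smul_eq_mul]; ring⟩ N
  refine convexHull_min ?_ hconv hp
  rintro _ ⟨d, hd, rfl⟩
  exact hle d hd

/-- A supporting line of the Newton polygon through two points of the support cuts out a side. -/
theorem isSide_of_supporting_line {x y N : ℝ}
    (hle : ∀ d ∈ f.support, x * (d 0 : ℝ) + y * (d 1 : ℝ) ≤ N) {d d' : Fin 2 →₀ ℕ}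
    (hd : d ∈ f.support) (hd' : d' ∈ f.support) (hne : d ≠ d') (hxy : x ≠ 0 ∨ y ≠ 0)
    (hdN : x * (d 0 : ℝ) + y * (d 1 : ℝ) = N) (hdN' : x * (d' 0 : ℝ) + y * (d' 1 : ℝ) = N) :
    IsSide (newtonPolygon f) {p ∈ newtonPolygon f | x * p.1 + y * p.2 = N} := by
  refine ⟨⟨fun p hp => hp.1, ?_⟩, ?_, ?_⟩
  · rintro p hp q hq _ ⟨-, hrN⟩ ⟨s, t, hs, ht, hst, rfl⟩
    refine ⟨hp, le_antisymm (linear_le_on_newtonPolygon hle hp) ?_⟩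
    have hq' := linear_le_on_newtonPolygon hle hq
    simp only [Prod.fst_add, Prod.snd_add, Prod.smul_fst, Prod.smul_snd, smul_eq_mul] at hrN
    by_contra! hlt
    have h1 := mul_lt_mul_of_pos_left hlt hs
    have h2 := mul_le_mul_of_nonneg_left hq' ht.le
    have h3 : s * N + t * N = N := by rw [← add_mul, hst, one_mul]
    nlinarith
  · rintro p ⟨hp, hpN⟩ q ⟨hq, hqN⟩ s t hs ht hst
    refine ⟨convex_convexHull ℝ _ hp hq hs ht hst, ?_⟩
    simp only [Prod.fst_add, Prod.snd_add, Prod.smul_fst, Prod.smul_snd, smul_eq_mul]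
    linear_combination s * hpN + t * hqN + N * hst
  · set e := {p ∈ newtonPolygon f | x * p.1 + y * p.2 = N}
    have he : ((d 0 : ℝ), (d 1 : ℝ)) ∈ e := ⟨mem_newtonPolygon_of_mem_support hd, hdN⟩
    have he' : ((d' 0 : ℝ), (d' 1 : ℝ)) ∈ e := ⟨mem_newtonPolygon_of_mem_support hd', hdN'⟩
    rw [direction_affineSpan]
    have hspan : vectorSpan ℝ e = ℝ ∙ ((-y, x) : ℝ × ℝ) := by
      apply le_antisymm
      · rw [vectorSpan_def, Submodule.span_le]
        rintro _ ⟨p, ⟨-, hp⟩, q, ⟨-, hq⟩, rfl⟩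
        rw [SetLike.mem_coe, Submodule.mem_span_singleton]
        simp only [vsub_eq_sub]
        rcases hxy with h | h
        · refine ⟨(p.2 - q.2) / x, Prod.ext ?_ ?_⟩
          · simp
            field_simp
            linarith
          · simp
            field_simp
        · refine ⟨-(p.1 - q.1) / y, Prod.ext ?_ ?_⟩
          · simp
            field_simp
            ring
          · simp
            field_simp
            linarith
      · rw [Submodule.span_singleton_le_iff_mem]
        have hv := vsub_mem_vectorSpan ℝ he he'
        simp only [vsub_eq_sub, Prod.mk_sub_mk] at hv
        have hlin : x * ((d 0 : ℝ) - d' 0) + y * ((d 1 : ℝ) - d' 1) = 0 := by linarith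
        rcases hxy with h | h
        · have hd1 : (d 1 : ℝ) - d' 1 ≠ 0 := by
            intro h1
            rw [h1, mul_zero, add_zero] at hlin
            have h0 := (mul_eq_zero.1 hlin).resolve_left h
            refine hne (Finsupp.ext fun i => ?_)
            fin_cases i
            · exact_mod_cast sub_eq_zero.1 h0
            · exact_mod_cast sub_eq_zero.1 h1
          have := Submodule.smul_mem _ (x / ((d 1 : ℝ) - d' 1)) hv
          convert this using 1
          refine Prod.ext ?_ ?_
          · simp
            field_simp
            linarith
          · simp
            field_simp
        · have hd0 : (d 0 : ℝ) - d' 0 ≠ 0 := by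
            intro h0
            rw [h0, mul_zero, zero_add] at hlin
            have h1 := (mul_eq_zero.1 hlin).resolve_left h
            refine hne (Finsupp.ext fun i => ?_)
            fin_cases i
            · exact_mod_cast sub_eq_zero.1 h0
            · exact_mod_cast sub_eq_zero.1 h1
          have := Submodule.smul_mem _ (-y / ((d 0 : ℝ) - d' 0)) hv
          convert this using 1
          refine Prod.ext ?_ ?_
          · simp
            field_simp
          · simp
            field_simp
            linarith
    rw [hspan, finrank_span_singleton]
    rintro h
    rw [Prod.mk_eq_zero, neg_eq_zero] at h
    exact hxy.elim (fun hx => hx h.2) fun hy => hy h.1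

open Classical in
/-- Weak nondegeneracy in terms of the monomials on a supporting line of the Newton polygon. -/
theorem WeaklyNondegenerate.not_singular_on_line (hnd : WeaklyNondegenerate f) {x y N : ℝ}
    (hle : ∀ d ∈ f.support, x * (d 0 : ℝ) + y * (d 1 : ℝ) ≤ N) {d d' : Fin 2 →₀ ℕ}
    (hd : d ∈ f.support) (hd' : d' ∈ f.support) (hne : d ≠ d') (hxy : x ≠ 0 ∨ y ≠ 0)
    (hdN : x * (d 0 : ℝ) + y * (d 1 : ℝ) = N) (hdN' : x * (d' 0 : ℝ) + y * (d' 1 : ℝ) = N)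
    (h0 : d 0 ≠ 0 ∨ d' 0 ≠ 0) (h1 : d 1 ≠ 0 ∨ d' 1 ≠ 0) {z w : ℂ} (hz : z ≠ 0) (hw : w ≠ 0)
    (hf : ∑ d ∈ f.support with x * ((d 0 : ℕ) : ℝ) + y * ((d 1 : ℕ) : ℝ) = N,
      MvPolynomial.coeff d f * z ^ d 0 * w ^ d 1 = 0)
    (hfz : ∑ d ∈ f.support with x * ((d 0 : ℕ) : ℝ) + y * ((d 1 : ℕ) : ℝ) = N,
      (d 0 : ℂ) * (MvPolynomial.coeff d f * z ^ d 0 * w ^ d 1) = 0)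
    (hfw : ∑ d ∈ f.support with x * ((d 0 : ℕ) : ℝ) + y * ((d 1 : ℕ) : ℝ) = N,
      (d 1 : ℂ) * (MvPolynomial.coeff d f * z ^ d 0 * w ^ d 1) = 0) : False := by
  obtain ⟨e, hemem, heside⟩ : ∃ e : Set (ℝ × ℝ),
      (∀ p, p ∈ e ↔ p ∈ newtonPolygon f ∧ x * p.1 + y * p.2 = N) ∧ IsSide (newtonPolygon f) e :=
    ⟨_, fun _ => Iff.rfl, isSide_of_supporting_line hle hd hd' hne hxy hdN hdN'⟩
  have he : ((d 0 : ℝ), (d 1 : ℝ)) ∈ e :=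
    (hemem _).2 ⟨mem_newtonPolygon_of_mem_support hd, hdN⟩
  have he' : ((d' 0 : ℝ), (d' 1 : ℝ)) ∈ e :=
    (hemem _).2 ⟨mem_newtonPolygon_of_mem_support hd', hdN'⟩
  have hside : sidePoly f e =
      ∑ d ∈ f.support with x * ((d 0 : ℕ) : ℝ) + y * ((d 1 : ℕ) : ℝ) = N,
        MvPolynomial.monomial d (MvPolynomial.coeff d f) := by
    rw [sidePoly]
    refine Finset.sum_congr (Finset.ext fun d => ?_) fun _ _ => rfl
    rw [Finset.mem_filter, Finset.mem_filter, hemem]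
    exact ⟨fun h => ⟨h.1, h.2.2⟩, fun h => ⟨h.1, mem_newtonPolygon_of_mem_support h.1, h.2⟩⟩
  have hmon : ∀ (d : Fin 2 →₀ ℕ) (a : ℂ),
      MvPolynomial.eval ![z, w] (MvPolynomial.monomial d a) = a * z ^ d 0 * w ^ d 1 := by
    intro d a
    rw [MvPolynomial.eval_monomial, Finsupp.prod_fintype _ _ fun i => pow_zero _,
      Fin.prod_univ_two, mul_assoc]
    rfl
  have hder : ∀ i, (![z, w] i) * MvPolynomial.eval ![z, w] (MvPolynomial.pderiv i (sidePoly f e)) =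
      ∑ d ∈ f.support with x * ((d 0 : ℕ) : ℝ) + y * ((d 1 : ℕ) : ℝ) = N,
      (d i : ℂ) * (MvPolynomial.coeff d f * z ^ d 0 * w ^ d 1) := by
    intro i
    rw [hside, map_sum, map_sum, Finset.mul_sum]
    refine Finset.sum_congr rfl fun d _ => ?_
    have := congrArg (MvPolynomial.eval ![z, w])
      (MvPolynomial.X_mul_pderiv_monomial (i := i) (m := d) (r := MvPolynomial.coeff d f))
    rw [map_mul, MvPolynomial.eval_X, map_nsmul, hmon, nsmul_eq_mul] at this
    exact this
  have haxis : ¬ (e ⊆ {p : ℝ × ℝ | p.1 = 0} ∨ e ⊆ {p : ℝ × ℝ | p.2 = 0}) := by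
    rintro (h | h)
    · rcases h0 with h0 | h0
      · exact h0 (Nat.cast_eq_zero.1 (h he))
      · exact h0 (Nat.cast_eq_zero.1 (h he'))
    · rcases h1 with h1 | h1
      · exact h1 (Nat.cast_eq_zero.1 (h he))
      · exact h1 (Nat.cast_eq_zero.1 (h he'))
  have hzero : MvPolynomial.eval ![z, w] (sidePoly f e) = 0 := by
    rw [hside, map_sum]
    simp only [hmon]
    exact hf
  rcases hnd e heside haxis z w hz hw hzero with h | h
  · exact mul_ne_zero hz h ((hder 0).trans hfz)
  · exact mul_ne_zero hw h ((hder 1).trans hfw)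

theorem NewtonBetween.le_of_mem_support {ℓ m : ℕ} (hΔ : NewtonBetween f ℓ m) {d : Fin 2 →₀ ℕ}
    (hd : d ∈ f.support) : d 0 ≤ ℓ ∧ d 1 ≤ m := by
  have h := (hΔ.2 (mem_newtonPolygon_of_mem_support hd)).2
  exact ⟨Nat.cast_le.1 h.1, Nat.cast_le.1 h.2⟩

theorem NewtonBetween.single_zero_mem_support {ℓ m : ℕ} (hΔ : NewtonBetween f ℓ m) :
    Finsupp.single 0 ℓ ∈ f.support := by
  by_contra hno
  have hmem : ((ℓ : ℝ), (0 : ℝ)) ∈ newtonPolygon f :=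
    hΔ.1 (subset_convexHull ℝ _ (by simp))
  have := linear_le_on_newtonPolygon (x := 1) (y := -1) (N := ℓ - 1) (fun d hd => ?_) hmem
  · norm_num at this
  have hle := hΔ.le_of_mem_support hd
  have : d 0 + 1 ≤ ℓ + d 1 := by
    by_contra! h
    have h0 : d 0 = ℓ := by omega
    have h1 : d 1 = 0 := by omega
    refine hno ?_
    convert hd
    ext i
    fin_cases i <;> simp [h0, h1]
  have : (d 0 : ℝ) + 1 ≤ ℓ + d 1 := by exact_mod_cast this
  linarith

theorem NewtonBetween.single_one_mem_support {ℓ m : ℕ} (hΔ : NewtonBetween f ℓ m) :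
    Finsupp.single 1 m ∈ f.support := by
  by_contra hno
  have hmem : ((0 : ℝ), (m : ℝ)) ∈ newtonPolygon f :=
    hΔ.1 (subset_convexHull ℝ _ (by simp))
  have := linear_le_on_newtonPolygon (x := -1) (y := 1) (N := m - 1) (fun d hd => ?_) hmem
  · norm_num at this
  have hle := hΔ.le_of_mem_support hd
  have : d 1 + 1 ≤ m + d 0 := by
    by_contra! h
    have h0 : d 0 = 0 := by omega
    have h1 : d 1 = m := by omega
    refine hno ?_
    convert hd
    ext i
    fin_cases i <;> simp [h0, h1]
  have : (d 1 : ℝ) + 1 ≤ m + d 0 := by exact_mod_cast this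
  linarith

theorem eval_coeff_toBivariate (f : MvPolynomial (Fin 2) ℂ) (j : ℕ) (z : ℂ) :
    ((toBivariate f).coeff j).eval z =
      ∑ d ∈ f.support with d 1 = j, MvPolynomial.coeff d f * z ^ d 0 := by
  rw [coeff_toBivariate, Polynomial.eval_finsetSum]
  simp

theorem mul_eval_derivative_coeff_toBivariate (f : MvPolynomial (Fin 2) ℂ) (j : ℕ) (z : ℂ) :
    z * ((toBivariate f).coeff j).derivative.eval z =
      ∑ d ∈ f.support with d 1 = j, (d 0 : ℂ) * (MvPolynomial.coeff d f * z ^ d 0) := by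
  rw [coeff_toBivariate, Polynomial.derivative_sum, Polynomial.eval_finsetSum, Finset.mul_sum]
  refine Finset.sum_congr rfl fun d _ => ?_
  simp only [Polynomial.derivative_mul, Polynomial.derivative_C, zero_mul, zero_add,
    Polynomial.derivative_X_pow, Polynomial.eval_mul, Polynomial.eval_C, Polynomial.eval_pow,
    Polynomial.eval_X]
  rcases d 0 with _ | k
  · simp
  · rw [Nat.add_sub_cancel, pow_succ]
    ring

/-- The leading coefficient in `w` has only simple zeros. -/
theorem WeaklyNondegenerate.eval_derivative_top_coeff_ne_zero (hnd : WeaklyNondegenerate f)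
    {ℓ m : ℕ} (hm : 1 ≤ m) (hΔ : NewtonBetween f ℓ m) {z : ℂ}
    (hz : ((toBivariate f).coeff m).eval z = 0) :
    ((toBivariate f).coeff m).derivative.eval z ≠ 0 := by
  intro hdz
  have hmem := hΔ.single_one_mem_support
  obtain ⟨hz0, d, hd, hd1, hd0⟩ : z ≠ 0 ∧ ∃ d ∈ f.support, d 1 = m ∧ d 0 ≠ 0 := by
    by_contra hno
    have : ((toBivariate f).coeff m).eval z = MvPolynomial.coeff (Finsupp.single 1 m) f := by
      rw [eval_coeff_toBivariate, Finset.sum_eq_single (Finsupp.single 1 m)]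
      · simp
      · intro d hd hne
        rw [Finset.mem_filter] at hd
        have hd0 : d 0 ≠ 0 := by
          intro h0
          refine hne (Finsupp.ext fun i => ?_)
          fin_cases i <;> simp [h0, hd.2]
        have hz0 : z = 0 := by
          by_contra hz0
          exact hno ⟨hz0, d, hd.1, hd.2, hd0⟩
        rw [hz0, zero_pow hd0, mul_zero]
      · intro h
        exact absurd (Finset.mem_filter.2 ⟨hmem, by simp⟩) h
    exact MvPolynomial.mem_support_iff.1 hmem (this.symm.trans hz)
  have hiff : ∀ d : Fin 2 →₀ ℕ, (0 : ℝ) * ((d 0 : ℕ) : ℝ) + 1 * ((d 1 : ℕ) : ℝ) = m ↔ d 1 = m := by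
    intro d
    rw [zero_mul, zero_add, one_mul, Nat.cast_inj]
  refine hnd.not_singular_on_line (x := 0) (y := 1) (N := m) (d := d) (d' := Finsupp.single 1 m)
    (z := z) (w := 1) ?_ hd hmem ?_ (Or.inr one_ne_zero) ?_ ?_ (Or.inl hd0)
    (Or.inl (by omega)) hz0 one_ne_zero ?_ ?_ ?_
  · intro d hd
    have := (hΔ.le_of_mem_support hd).2
    rw [zero_mul, zero_add, one_mul]
    exact_mod_cast this
  · rintro rfl
    simp at hd0
  · exact (hiff d).2 hd1
  · exact (hiff _).2 (by simp)
  · simp only [hiff, one_pow, mul_one]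
    rw [← eval_coeff_toBivariate, hz]
  · simp only [hiff, one_pow, mul_one]
    rw [← mul_eval_derivative_coeff_toBivariate, hdz, mul_zero]
  · simp only [hiff, one_pow, mul_one]
    rw [Finset.sum_congr rfl (g := fun d => (m : ℂ) * (MvPolynomial.coeff d f * z ^ d 0))
      fun d hd => by rw [(Finset.mem_filter.1 hd).2], ← Finset.mul_sum,
      ← eval_coeff_toBivariate, hz, mul_zero]

/-- The equation of the fiber of `f` over `ξ`. -/
noncomputable def fiberPoly (f : MvPolynomial (Fin 2) ℂ) (ξ : ℂ) : Polynomial (Polynomial ℂ) :=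
  toBivariate f - Polynomial.C (Polynomial.C ξ)

theorem evalEval_fiberPoly (f : MvPolynomial (Fin 2) ℂ) (ξ z w : ℂ) :
    (fiberPoly f ξ).evalEval z w = MvPolynomial.eval ![z, w] f - ξ := by
  rw [fiberPoly, Polynomial.evalEval_sub, evalEval_toBivariate, Polynomial.evalEval_C,
    Polynomial.eval_C]

theorem coeff_fiberPoly (f : MvPolynomial (Fin 2) ℂ) (ξ : ℂ) {j : ℕ} (hj : 1 ≤ j) :
    (fiberPoly f ξ).coeff j = (toBivariate f).coeff j := by
  rw [fiberPoly, Polynomial.coeff_sub, Polynomial.coeff_C_of_ne_zero (by omega), sub_zero]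

theorem pderiv_ofBivariate_fiberPoly (f : MvPolynomial (Fin 2) ℂ) (ξ : ℂ) (i : Fin 2) :
    MvPolynomial.pderiv i (ofBivariate (fiberPoly f ξ)) = MvPolynomial.pderiv i f := by
  have : ofBivariate (Polynomial.C (Polynomial.C ξ)) = MvPolynomial.C ξ := by
    simp [ofBivariate, MvPolynomial.algebraMap_eq]
  rw [fiberPoly, map_sub, ofBivariate_toBivariate, this, map_sub, MvPolynomial.pderiv_C, sub_zero]

theorem not_singular_of_notMem_criticalValues {ξ : ℂ} (hξ : ξ ∉ criticalValues f) {z w : ℂ}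
    (h : (fiberPoly f ξ).evalEval z w = 0)
    (h0 : MvPolynomial.eval ![z, w] (MvPolynomial.pderiv 0 (ofBivariate (fiberPoly f ξ))) = 0)
    (h1 : MvPolynomial.eval ![z, w] (MvPolynomial.pderiv 1 (ofBivariate (fiberPoly f ξ))) = 0) :
    False := by
  rw [pderiv_ofBivariate_fiberPoly] at h0 h1
  rw [evalEval_fiberPoly, sub_eq_zero] at h
  exact hξ ⟨_, h0, h1, h⟩

/-- A regular fiber contains no vertical line. -/
theorem map_fiberPoly_ne_zero (hnd : WeaklyNondegenerate f) {ℓ m : ℕ} (hm : 1 ≤ m)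
    (hΔ : NewtonBetween f ℓ m) {ξ : ℂ} (hξ : ξ ∉ criticalValues f) (z : ℂ) :
    (fiberPoly f ξ).map (Polynomial.evalRingHom z) ≠ 0 := by
  intro h
  obtain ⟨H, hH⟩ : Polynomial.C (Polynomial.X - Polynomial.C z) ∣ fiberPoly f ξ := by
    rw [Polynomial.C_dvd_iff_dvd_coeff]
    intro j
    rw [Polynomial.dvd_iff_isRoot]
    have := congrArg (Polynomial.coeff · j) h
    simpa [Polynomial.coeff_map] using this
  have hC : ofBivariate (Polynomial.C (Polynomial.X - Polynomial.C z)) =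
      MvPolynomial.X 0 - MvPolynomial.C z := by
    simp [ofBivariate, MvPolynomial.algebraMap_eq]
  have hroot : ∀ w, H.evalEval z w ≠ 0 := by
    intro w hw
    have hw' : MvPolynomial.eval ![z, w] (ofBivariate H) = 0 := by rw [eval_ofBivariate, hw]
    refine not_singular_of_notMem_criticalValues hξ (z := z) (w := w) ?_ ?_ ?_
    · rw [hH, Polynomial.evalEval_mul, hw, mul_zero]
    · rw [hH, map_mul, hC]
      simp [Derivation.leibniz, hw']
    · rw [hH, map_mul, hC]
      simp [Derivation.leibniz]
  have hdeg : (H.map (Polynomial.evalRingHom z)).degree = 0 := by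
    by_contra hdeg
    obtain ⟨w, hw⟩ := IsAlgClosed.exists_root _ hdeg
    refine hroot w ?_
    rw [Polynomial.IsRoot, Polynomial.eval_map] at hw
    rw [← hw, ← Polynomial.eval₂_evalRingHom]
  have hHm : (H.coeff m).eval z = 0 := by
    have := Polynomial.coeff_eq_zero_of_degree_lt (n := m)
      (hdeg.trans_lt (by exact_mod_cast hm))
    simpa [Polynomial.coeff_map] using this
  have hcoeff : (toBivariate f).coeff m = (Polynomial.X - Polynomial.C z) * H.coeff m := by
    rw [← coeff_fiberPoly f ξ hm, hH, Polynomial.coeff_C_mul]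
  refine hnd.eval_derivative_top_coeff_ne_zero hm hΔ (z := z) ?_ ?_
  · rw [hcoeff]
    simp
  · rw [hcoeff]
    simp [hHm]

/-- Away from finitely many vertical lines a regular fiber is unramified over the `z`-axis. -/
theorem exists_simple_roots_fiberPoly {ξ : ℂ} (hξ : ξ ∉ criticalValues f)
    (h0 : fiberPoly f ξ ≠ 0) :
    ∃ c : Polynomial ℂ, c ≠ 0 ∧ ∀ z, c.eval z ≠ 0 → ∀ w, (fiberPoly f ξ).evalEval z w = 0 →
      (fiberPoly f ξ).derivative.evalEval z w ≠ 0 := by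
  refine exists_simple_roots_of_squarefree _ h0 fun b G H hb hG => ?_
  by_contra hdeg
  have hG0 : G ≠ 0 := by
    rintro rfl
    simp at hdeg
  obtain ⟨z, hz⟩ : ∃ z, (b * G.leadingCoeff).eval z ≠ 0 := by
    by_contra! hall
    exact mul_ne_zero hb (Polynomial.leadingCoeff_ne_zero.2 hG0)
      (Polynomial.funext fun z => by rw [hall z, Polynomial.eval_zero])
  rw [Polynomial.eval_mul, mul_ne_zero_iff] at hz
  have hdeg' : (G.map (Polynomial.evalRingHom z)).degree ≠ 0 := by
    rw [Polynomial.degree_map_eq_of_leadingCoeff_ne_zero _ hz.2,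
      Polynomial.degree_eq_natDegree hG0]
    exact_mod_cast hdeg
  obtain ⟨w, hw⟩ := IsAlgClosed.exists_root _ hdeg'
  have hGw : G.evalEval z w = 0 := by
    rw [Polynomial.IsRoot, Polynomial.eval_map] at hw
    rw [← hw, ← Polynomial.eval₂_evalRingHom]
  have hGw' : MvPolynomial.eval ![z, w] (ofBivariate G) = 0 := by rw [eval_ofBivariate, hGw]
  have hF : (fiberPoly f ξ).evalEval z w = 0 := by
    have := congrArg (Polynomial.evalEval z w) hG
    simp only [Polynomial.evalEval_mul, Polynomial.evalEval_C, hGw, zero_mul] at this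
    exact (mul_eq_zero.1 this).resolve_left hz.1
  have hF' : MvPolynomial.eval ![z, w] (ofBivariate (fiberPoly f ξ)) = 0 := by
    rw [eval_ofBivariate, hF]
  have hder : ∀ i, MvPolynomial.eval ![z, w]
      (MvPolynomial.pderiv i (ofBivariate (fiberPoly f ξ))) = 0 := by
    intro i
    have := congrArg (fun Q => MvPolynomial.eval ![z, w] (MvPolynomial.pderiv i (ofBivariate Q))) hG
    simp only [map_mul, Derivation.leibniz, smul_eq_mul, map_add, hGw', hF', zero_mul, mul_zero,
      add_zero, eval_ofBivariate, Polynomial.evalEval_C] at this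
    exact (mul_eq_zero.1 this).resolve_left hz.1
  exact not_singular_of_notMem_criticalValues hξ hF (hder 0) (hder 1)

theorem Ultrafilter.exists_tendsto_of_norm_le {ι : Type*} (l : Ultrafilter ι) {u : ι → ℂ} {C : ℝ}
    (h : ∀ᶠ i in l, ‖u i‖ ≤ C) : ∃ a, Tendsto u l (𝓝 a) := by
  obtain ⟨a, -, ha⟩ := (isCompact_closedBall (0 : ℂ) C).ultrafilter_le_nhds (l.map u) <| by
    rw [Ultrafilter.coe_map, le_principal_iff, Filter.mem_map]
    filter_upwards [h] with i hi
    simpa using hi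
  exact ⟨a, ha⟩

theorem Ultrafilter.exists_eventually_of_eventually_exists {ι α : Type*} (l : Ultrafilter ι)
    (S : Finset α) {p : α → ι → Prop} (h : ∀ᶠ i in l, ∃ a ∈ S, p a i) :
    ∃ a ∈ S, ∀ᶠ i in l, p a i := by
  have : (⋃ a ∈ (S : Set α), {i | p a i}) ∈ l := by
    filter_upwards [h] with i hi
    simpa using hi
  obtain ⟨a, ha, h⟩ := (Ultrafilter.finite_biUnion_mem_iff S.finite_toSet).1 this
  exact ⟨a, ha, h⟩

theorem eval_eq_sum_support (f : MvPolynomial (Fin 2) ℂ) (z w : ℂ) :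
    MvPolynomial.eval ![z, w] f =
      ∑ d ∈ f.support, MvPolynomial.coeff d f * (z ^ d 0 * w ^ d 1) := by
  rw [MvPolynomial.eval_eq']
  simp [Fin.prod_univ_two]

/-- Two distinct zeros of an equation `∑ c_d w^{n_d} = ξ` whose ratio is `s` satisfy the divided
difference of the equation. -/
theorem sum_mul_geom_sum_eq_zero {α : Type*} {S : Finset α} {c : α → ℂ} {n : α → ℕ} {w w' ξ : ℂ}
    (hw : w ≠ 0) (hne : w ≠ w') (h : ∑ d ∈ S, c d * w ^ n d = ξ)
    (h' : ∑ d ∈ S, c d * w' ^ n d = ξ) :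
    ∑ d ∈ S, c d * w ^ n d * ∑ i ∈ Finset.range (n d), (w' / w) ^ i = 0 := by
  have hs : w' / w - 1 ≠ 0 := by
    rw [sub_ne_zero, Ne, div_eq_one_iff_eq hw]
    exact hne.symm
  refine ((mul_eq_zero (a := w' / w - 1)).1 ?_).resolve_left hs
  rw [← sub_eq_zero.2 (h'.trans h.symm), ← Finset.sum_sub_distrib, Finset.mul_sum]
  refine Finset.sum_congr rfl fun d _ => ?_
  rw [mul_left_comm, mul_geom_sum, div_pow]
  field_simp

theorem tendsto_geom_sum_one {ι : Type*} {l : Filter ι} {s : ι → ℂ} (hs : Tendsto s l (𝓝 1))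
    (n : ℕ) : Tendsto (fun i => ∑ k ∈ Finset.range n, s i ^ k) l (𝓝 n) := by
  have := tendsto_finsetSum (Finset.range n) fun k _ => hs.pow k
  simpa using this

/-- If a monomial dominates along a branch where `z → ∞`, then the limits of the ratios of the
other monomials to it are cut out by a supporting line of the Newton polygon. -/
theorem exists_supporting_line_of_tendsto {ι : Type*} (l : Ultrafilter ι) {z w : ι → ℂ}
    (hz : Tendsto (fun i => ‖z i‖) l atTop) (hw : ∀ᶠ i in l, w i ≠ 0) {S : Finset (Fin 2 →₀ ℕ)}
    {d d' : Fin 2 →₀ ℕ} (hd' : d' ∈ S) (hne : d' ≠ d) {r : (Fin 2 →₀ ℕ) → ℂ}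
    (hr : ∀ e ∈ S, Tendsto (fun i => z i ^ e 0 * w i ^ e 1 / (z i ^ d 0 * w i ^ d 1)) l (𝓝 (r e)))
    (hr' : r d' ≠ 0) :
    d' 1 ≠ d 1 ∧ ∃ (α : ℝ) (z₀ w₀ : ℂ), z₀ ≠ 0 ∧ w₀ ≠ 0 ∧
      (d' 0 : ℝ) + α * (d' 1 : ℝ) = (d 0 : ℝ) + α * (d 1 : ℝ) ∧
      (∀ e ∈ S, (e 0 : ℝ) + α * (e 1 : ℝ) ≤ (d 0 : ℝ) + α * (d 1 : ℝ)) ∧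
      (∀ e ∈ S, (e 0 : ℝ) + α * (e 1 : ℝ) ≠ (d 0 : ℝ) + α * (d 1 : ℝ) → r e = 0) ∧
      ∀ e ∈ S, (e 0 : ℝ) + α * (e 1 : ℝ) = (d 0 : ℝ) + α * (d 1 : ℝ) →
        r e = z₀ ^ e 0 * w₀ ^ e 1 / (z₀ ^ d 0 * w₀ ^ d 1) := by
  have hz0 : ∀ᶠ i in l, 0 < ‖z i‖ := hz.eventually_gt_atTop 0
  have hlogz : Tendsto (fun i => Real.log ‖z i‖) l atTop := Real.tendsto_log_atTop.comp hz
  have hlog : Tendsto (fun i => ((d' 0 : ℝ) - d 0) * Real.log ‖z i‖ +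
      ((d' 1 : ℝ) - d 1) * Real.log ‖w i‖) l (𝓝 (Real.log ‖r d'‖)) := by
    refine Tendsto.congr' ?_ ((hr d' hd').norm.log (norm_ne_zero_iff.2 hr'))
    filter_upwards [hz0, hw] with i hzi hwi
    have hwi := norm_pos_iff.2 hwi
    rw [norm_div, norm_mul, norm_mul, norm_pow, norm_pow, norm_pow, norm_pow,
      Real.log_div (by positivity) (by positivity), Real.log_mul (by positivity) (by positivity),
      Real.log_mul (by positivity) (by positivity), Real.log_pow, Real.log_pow, Real.log_pow,
      Real.log_pow]
    ring
  have hd1 : d' 1 ≠ d 1 := by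
    intro h1
    have h0 : (d' 0 : ℝ) - d 0 ≠ 0 := by
      intro h0
      refine hne (Finsupp.ext fun i => ?_)
      fin_cases i
      · exact_mod_cast sub_eq_zero.1 h0
      · exact h1
    simp only [h1, sub_self, zero_mul, add_zero] at hlog
    refine not_tendsto_nhds_of_tendsto_atTop hlogz (((d' 0 : ℝ) - d 0)⁻¹ * Real.log ‖r d'‖) ?_
    refine (hlog.const_mul ((d' 0 : ℝ) - d 0)⁻¹).congr fun i => ?_
    rw [inv_mul_cancel_left₀ h0]
  have hδ : (d' 1 : ℝ) - d 1 ≠ 0 := sub_ne_zero.2 (Nat.cast_injective.ne hd1)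
  refine ⟨hd1, -((d' 0 : ℝ) - d 0) / ((d' 1 : ℝ) - d 1), ?_⟩
  set α := -((d' 0 : ℝ) - d 0) / ((d' 1 : ℝ) - d 1) with hα
  obtain ⟨z₀, hz₀⟩ := l.exists_tendsto_of_norm_le (u := fun i => z i / (‖z i‖ : ℂ)) (C := 1) <| by
    filter_upwards [hz0] with i hi
    rw [norm_div, Complex.norm_real, norm_norm, div_self hi.ne']
  have hz₀n : z₀ ≠ 0 := by
    have h1 : Tendsto (fun i => ‖z i / (‖z i‖ : ℂ)‖) l (𝓝 1) := by
      refine tendsto_const_nhds.congr' ?_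
      filter_upwards [hz0] with i hi
      rw [norm_div, Complex.norm_real, norm_norm, div_self hi.ne']
    have := tendsto_nhds_unique hz₀.norm h1
    rw [← norm_ne_zero_iff, this]
    exact one_ne_zero
  have hwn : Tendsto (fun i => ‖w i / ((‖z i‖ ^ α : ℝ) : ℂ)‖) l
      (𝓝 (Real.exp (((d' 1 : ℝ) - d 1)⁻¹ * Real.log ‖r d'‖))) := by
    refine ((Real.continuous_exp.tendsto _).comp (hlog.const_mul ((d' 1 : ℝ) - d 1)⁻¹)).congr' ?_
    filter_upwards [hz0, hw] with i hzi hwi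
    have hwi := norm_pos_iff.2 hwi
    rw [norm_div, Complex.norm_real, Real.norm_of_nonneg (by positivity), Function.comp_apply,
      Real.rpow_def_of_pos hzi, ← Real.exp_log hwi, ← Real.exp_sub, Real.exp_log hwi, hα]
    congr 1
    field_simp
    ring
  obtain ⟨w₀, hw₀⟩ := l.exists_tendsto_of_norm_le
    (u := fun i => w i / ((‖z i‖ ^ α : ℝ) : ℂ)) (hwn.eventually_le_const (lt_add_one _))
  have hw₀n : w₀ ≠ 0 := by
    rw [← norm_ne_zero_iff, tendsto_nhds_unique hw₀.norm hwn]
    exact (Real.exp_pos _).ne'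
  have hquot : ∀ e ∈ S, Tendsto (fun i => ((‖z i‖ ^ ((e 0 : ℝ) + α * (e 1 : ℝ) -
      ((d 0 : ℝ) + α * (d 1 : ℝ))) : ℝ) : ℂ)) l
      (𝓝 (r e / (z₀ ^ e 0 * w₀ ^ e 1 / (z₀ ^ d 0 * w₀ ^ d 1)))) := by
    intro e he
    refine ((hr e he).div (((hz₀.pow (e 0)).mul (hw₀.pow (e 1))).div
      ((hz₀.pow (d 0)).mul (hw₀.pow (d 1))) (by positivity)) (by positivity)).congr' ?_
    filter_upwards [hz0, hw] with i hzi hwi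
    have hzi' := norm_pos_iff.1 hzi
    have h1 : ((‖z i‖ : ℝ) : ℂ) ≠ 0 := Complex.ofReal_ne_zero.2 hzi.ne'
    have h2 : ((‖z i‖ ^ α : ℝ) : ℂ) ≠ 0 := Complex.ofReal_ne_zero.2 (by positivity)
    rw [Real.rpow_sub hzi, Real.rpow_add hzi, Real.rpow_add hzi, Real.rpow_mul hzi.le,
      Real.rpow_mul hzi.le, Real.rpow_natCast, Real.rpow_natCast, Real.rpow_natCast,
      Real.rpow_natCast]
    simp only [Pi.div_apply, div_pow]
    push_cast
    field_simp
  have hle : ∀ e ∈ S, (e 0 : ℝ) + α * (e 1 : ℝ) ≤ (d 0 : ℝ) + α * (d 1 : ℝ) := by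
    intro e he
    by_contra! hlt
    refine not_tendsto_nhds_of_tendsto_atTop
      ((tendsto_rpow_atTop (sub_pos.2 hlt)).comp hz) _ ((hquot e he).norm.congr' ?_)
    filter_upwards [hz0] with i hi
    rw [Complex.norm_real, Real.norm_of_nonneg (by positivity), Function.comp_apply]
  refine ⟨z₀, w₀, hz₀n, hw₀n, ?_, hle, fun e he hlt => ?_, fun e he heq => ?_⟩
  · rw [hα]
    field_simp
    ring
  · have hneg := lt_of_le_of_ne (hle e he) hlt
    have h0 : Tendsto (fun i => ((‖z i‖ ^ ((e 0 : ℝ) + α * (e 1 : ℝ) -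
        ((d 0 : ℝ) + α * (d 1 : ℝ))) : ℝ) : ℂ)) l (𝓝 ((0 : ℝ) : ℂ)) := by
      refine (Complex.continuous_ofReal.tendsto _).comp ?_
      refine ((tendsto_rpow_neg_atTop (sub_pos.2 hneg)).comp hz).congr fun i => ?_
      rw [Function.comp_apply, neg_sub]
    have := tendsto_nhds_unique (hquot e he) h0
    rw [Complex.ofReal_zero, div_eq_zero_iff] at this
    exact this.resolve_right (by positivity)
  · have h1 := hquot e he
    simp only [heq, sub_self, Real.rpow_zero, Complex.ofReal_one] at h1
    have := tendsto_nhds_unique h1 tendsto_const_nhds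
    rwa [div_eq_one_iff_eq (by positivity)] at this

/-- Two distinct points of a fiber over the same `z` cannot become asymptotically equal as
`z → ∞`. -/
theorem WeaklyNondegenerate.not_tendsto_div_of_tendsto_atTop (hnd : WeaklyNondegenerate f)
    {ℓ m : ℕ} (hℓ : 1 ≤ ℓ) (hΔ : NewtonBetween f ℓ m) {ξ : ℂ} {ι : Type*} (l : Ultrafilter ι)
    {z w w' : ι → ℂ} (hz : Tendsto (fun i => ‖z i‖) l atTop) (hw : ∀ᶠ i in l, w i ≠ 0)
    (hs : Tendsto (fun i => w' i / w i) l (𝓝 1)) (hne : ∀ᶠ i in l, w i ≠ w' i)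
    (hF : ∀ᶠ i in l, MvPolynomial.eval ![z i, w i] f = ξ)
    (hF' : ∀ᶠ i in l, MvPolynomial.eval ![z i, w' i] f = ξ) : False := by
  have hz1 : ∀ᶠ i in l, 1 ≤ ‖z i‖ := hz.eventually_ge_atTop 1
  have hℓmem := hΔ.single_zero_mem_support
  obtain ⟨d, hd, hmax⟩ := l.exists_eventually_of_eventually_exists f.support
    (p := fun d i => ∀ e ∈ f.support, ‖z i ^ e 0 * w i ^ e 1‖ ≤ ‖z i ^ d 0 * w i ^ d 1‖)
    (Eventually.of_forall fun i => f.support.exists_max_image _ ⟨_, hℓmem⟩)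
  have hr : ∀ e ∈ f.support, ∃ r,
      Tendsto (fun i => z i ^ e 0 * w i ^ e 1 / (z i ^ d 0 * w i ^ d 1)) l (𝓝 r) := by
    intro e he
    refine l.exists_tendsto_of_norm_le (C := 1) ?_
    filter_upwards [hmax] with i hi
    rw [norm_div]
    exact div_le_one_of_le₀ (hi e he) (norm_nonneg _)
  choose! r hr using hr
  have hdom : ∀ᶠ i in l, z i ^ d 0 * w i ^ d 1 ≠ 0 := by
    filter_upwards [hz1, hw] with i hzi hwi
    have : z i ≠ 0 := norm_pos_iff.1 (by linarith)
    positivity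
  have hrd : r d = 1 := by
    refine tendsto_nhds_unique (hr d hd) (tendsto_const_nhds.congr' ?_)
    filter_upwards [hdom] with i hi
    rw [div_self hi]
  have hdominf : Tendsto (fun i => ‖z i ^ d 0 * w i ^ d 1‖) l atTop := by
    refine tendsto_atTop_mono' _ ?_ hz
    filter_upwards [hmax, hz1] with i hi hzi
    refine le_trans ?_ (hi _ hℓmem)
    simpa using le_self_pow₀ hzi (by omega : ℓ ≠ 0)
  have hsum : ∑ e ∈ f.support, MvPolynomial.coeff e f * r e = 0 := by
    refine tendsto_nhds_unique (tendsto_finsetSum _ fun e he => (hr e he).const_mul _) ?_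
    have h0 : Tendsto (fun i => ξ * (z i ^ d 0 * w i ^ d 1)⁻¹) l (𝓝 (ξ * 0)) :=
      (tendsto_inv₀_cobounded.comp (tendsto_norm_atTop_iff_cobounded.1 hdominf)).const_mul ξ
    rw [mul_zero] at h0
    refine h0.congr' ?_
    filter_upwards [hF] with i hi
    rw [← hi, eval_eq_sum_support, Finset.sum_mul]
    exact Finset.sum_congr rfl fun e _ => by rw [mul_assoc, ← div_eq_mul_inv]
  have hsum1 : ∑ e ∈ f.support, MvPolynomial.coeff e f * r e * (e 1 : ℂ) = 0 := by
    refine tendsto_nhds_unique (tendsto_finsetSum _ fun e he =>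
      ((hr e he).const_mul _).mul (tendsto_geom_sum_one hs (e 1))) ?_
    refine tendsto_const_nhds.congr' ?_
    filter_upwards [hF, hF', hw, hne] with i hi hi' hwi hnei
    rw [eval_eq_sum_support] at hi hi'
    have := sum_mul_geom_sum_eq_zero (S := f.support) (n := fun e => e 1)
      (c := fun e => MvPolynomial.coeff e f * z i ^ e 0) hwi hnei
      (by simpa only [mul_assoc] using hi) (by simpa only [mul_assoc] using hi')
    rw [← zero_div (z i ^ d 0 * w i ^ d 1), ← this, Finset.sum_div]
    exact Finset.sum_congr rfl fun e _ => by ring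
  obtain ⟨d', hd', hne', hr'⟩ : ∃ d' ∈ f.support, d' ≠ d ∧ r d' ≠ 0 := by
    by_contra! hall
    rw [Finset.sum_eq_single d (fun e he hed => by rw [hall e he hed, mul_zero])
      (fun h => absurd hd h), hrd, mul_one] at hsum
    exact MvPolynomial.mem_support_iff.1 hd hsum
  obtain ⟨hd1, α, z₀, w₀, hz₀, hw₀, hline, hle, hzero, hval⟩ :=
    exists_supporting_line_of_tendsto l hz hw hd' hne' hr hr'
  set N := (d 0 : ℝ) + α * (d 1 : ℝ) with hN
  have hT : z₀ ^ d 0 * w₀ ^ d 1 ≠ 0 := by positivity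
  have hcut : ∀ c : (Fin 2 →₀ ℕ) → ℂ,
      ∑ e ∈ f.support with 1 * ((e 0 : ℕ) : ℝ) + α * ((e 1 : ℕ) : ℝ) = N,
        c e * (MvPolynomial.coeff e f * z₀ ^ e 0 * w₀ ^ e 1) =
      (∑ e ∈ f.support, c e * (MvPolynomial.coeff e f * r e)) * (z₀ ^ d 0 * w₀ ^ d 1) := by
    intro c
    rw [Finset.sum_filter, Finset.sum_mul]
    refine Finset.sum_congr rfl fun e he => ?_
    rw [one_mul]
    split_ifs with h
    · rw [hval e he h]
      field_simp
    · rw [hzero e he h]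
      ring
  have hS : ∑ e ∈ f.support with 1 * ((e 0 : ℕ) : ℝ) + α * ((e 1 : ℕ) : ℝ) = N,
        (MvPolynomial.coeff e f * z₀ ^ e 0 * w₀ ^ e 1) = 0 := by
    have := hcut fun _ => 1
    simpa only [one_mul, hsum, zero_mul] using this
  have hS1 : ∑ e ∈ f.support with 1 * ((e 0 : ℕ) : ℝ) + α * ((e 1 : ℕ) : ℝ) = N,
        (e 1 : ℂ) * (MvPolynomial.coeff e f * z₀ ^ e 0 * w₀ ^ e 1) = 0 := by
    rw [hcut fun e => (e 1 : ℂ), Finset.sum_congr rfl fun e _ => mul_comm (e 1 : ℂ) _, hsum1,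
      zero_mul]
  refine hnd.not_singular_on_line (x := 1) (y := α) (N := N) (by simpa using hle) hd hd' hne'.symm
    (Or.inl one_ne_zero) (by rw [one_mul]) (by rw [one_mul, hline]) ?_ (by omega) hz₀ hw₀
    hS ?_ hS1
  · by_contra! h
    have hα : α = 0 := by
      rw [hN, h.1, h.2, Nat.cast_zero, zero_add, zero_add, mul_eq_mul_left_iff] at hline
      exact hline.resolve_left (Nat.cast_injective.ne hd1)
    have := hle _ hℓmem
    rw [hN, hα, h.1] at this
    simp at this
    omega
  · rw [Finset.sum_congr rfl (g := fun e => (N : ℂ) * (MvPolynomial.coeff e f * z₀ ^ e 0 *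
      w₀ ^ e 1) - (α : ℂ) * ((e 1 : ℂ) * (MvPolynomial.coeff e f * z₀ ^ e 0 * w₀ ^ e 1)))
      fun e he => ?_, Finset.sum_sub_distrib, ← Finset.mul_sum, ← Finset.mul_sum, hS, hS1]
    · ring
    · rw [← (Finset.mem_filter.1 he).2]
      push_cast
      ring

theorem tendsto_sum_range_mul_pow {ι : Type*} {l : Filter ι} {n : ℕ} {u : ℕ → ι → ℂ} {a : ℕ → ℂ}
    {v : ι → ℂ} (hu : ∀ j, Tendsto (u j) l (𝓝 (a j))) (hv : Tendsto v l (𝓝 0)) :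
    Tendsto (fun i => ∑ j ∈ Finset.range (n + 1), u j i * v i ^ j) l (𝓝 (a 0)) := by
  have := tendsto_finsetSum (Finset.range (n + 1)) fun j _ => (hu j).mul (hv.pow j)
  rw [Finset.sum_range_succ'] at this
  simpa using this

/-- Two distinct points of a plane curve over the same `z` cannot become asymptotically equal
along a vertical asymptote, when the leading coefficient has a simple zero there. -/
theorem not_tendsto_div_of_tendsto_nhds {P : Polynomial (Polynomial ℂ)} {m : ℕ}
    (hdeg : P.natDegree ≤ m) {z₀ : ℂ}
    (hsimple : (P.coeff m).eval z₀ = 0 → (P.coeff m).derivative.eval z₀ ≠ 0)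
    (hv : P.map (Polynomial.evalRingHom z₀) ≠ 0) {ι : Type*} (l : Filter ι) [l.NeBot]
    {z w w' : ι → ℂ} (hz : Tendsto z l (𝓝 z₀)) (hw : Tendsto (fun i => ‖w i‖) l atTop)
    (hs : Tendsto (fun i => w' i / w i) l (𝓝 1)) (hne : ∀ᶠ i in l, w i ≠ w' i)
    (hP : ∀ᶠ i in l, P.evalEval (z i) (w i) = 0) (hP' : ∀ᶠ i in l, P.evalEval (z i) (w' i) = 0) :
    False := by
  have hw0 : ∀ᶠ i in l, w i ≠ 0 := by
    filter_upwards [hw.eventually_gt_atTop 0] with i hi using norm_pos_iff.1 hi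
  have hinv : Tendsto (fun i => (w i)⁻¹) l (𝓝 0) :=
    tendsto_inv₀_cobounded.comp (tendsto_norm_atTop_iff_cobounded.1 hw)
  have heval : ∀ z w, P.evalEval z w = ∑ j ∈ Finset.range (m + 1), (P.coeff j).eval z * w ^ j := by
    intro z w
    rw [Polynomial.evalEval, Polynomial.eval_eq_sum_range' (Nat.lt_succ_of_le hdeg),
      Polynomial.eval_finsetSum]
    simp
  set b : ℕ → Polynomial ℂ := fun j => P.coeff (m - j) with hb
  have hreflect : ∀ (z w : ℂ) (τ : ℕ → ℂ), w ≠ 0 →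
      ∑ j ∈ Finset.range (m + 1), (P.coeff j).eval z * w ^ j * τ j = 0 →
      ∑ j ∈ Finset.range (m + 1), (b j).eval z * τ (m - j) * w⁻¹ ^ j = 0 := by
    intro z w τ hw h
    rw [← Finset.sum_range_reflect] at h
    rw [← mul_eq_zero_iff_left (pow_ne_zero m hw), Finset.mul_sum, ← h]
    refine Finset.sum_congr rfl fun j hj => ?_
    have hj : j ≤ m := Nat.lt_succ_iff.1 (Finset.mem_range.1 hj)
    rw [Nat.add_sub_cancel, inv_pow, pow_sub₀ _ hw hj]
    ring
  have hE : ∀ᶠ i in l, ∑ j ∈ Finset.range (m + 1), (b j).eval (z i) * 1 * (w i)⁻¹ ^ j = 0 := by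
    filter_upwards [hP, hw0] with i hi hwi
    rw [heval] at hi
    exact hreflect _ _ (fun _ => 1) hwi (by simpa using hi)
  have hE' : ∀ᶠ i in l, ∑ j ∈ Finset.range (m + 1), (b j).eval (z i) *
      (∑ k ∈ Finset.range (m - j), (w' i / w i) ^ k) * (w i)⁻¹ ^ j = 0 := by
    filter_upwards [hP, hP', hw0, hne] with i hi hi' hwi hnei
    rw [heval] at hi hi'
    exact hreflect _ _ (fun j => ∑ k ∈ Finset.range j, (w' i / w i) ^ k) hwi
      (sum_mul_geom_sum_eq_zero (n := fun j => j) hwi hnei hi hi')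
  have hbz : ∀ j, Tendsto (fun i => (b j).eval (z i)) l (𝓝 ((b j).eval z₀)) := fun j =>
    ((b j).continuous.tendsto z₀).comp hz
  have hb0 : (b 0).eval z₀ = 0 := by
    have h1 := tendsto_sum_range_mul_pow (n := m)
      (fun j => (hbz j).mul (tendsto_const_nhds (x := (1 : ℂ)))) hinv
    rw [mul_one] at h1
    exact tendsto_nhds_unique h1 (tendsto_const_nhds.congr' (hE.mono fun i hi => hi.symm))
  have hex : ∃ k, k ≤ m ∧ (b k).eval z₀ ≠ 0 := by
    by_contra! hall
    refine hv (Polynomial.ext fun j => ?_)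
    rw [Polynomial.coeff_map, Polynomial.coeff_zero, Polynomial.coe_evalRingHom]
    by_cases hj : j ≤ m
    · have := hall (m - j) (Nat.sub_le _ _)
      simpa only [hb, Nat.sub_sub_self hj] using this
    · rw [Polynomial.coeff_eq_zero_of_natDegree_lt (by omega), Polynomial.eval_zero]
  classical
  obtain ⟨k, ⟨hkm, hk⟩, hmin⟩ : ∃ k, (k ≤ m ∧ (b k).eval z₀ ≠ 0) ∧ ∀ j < k, (b j).eval z₀ = 0 := by
    refine ⟨Nat.find hex, Nat.find_spec hex, fun j hj => ?_⟩
    have hjm := hj.le.trans (Nat.find_spec hex).1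
    by_contra h
    exact Nat.find_min hex hj ⟨hjm, h⟩
  obtain ⟨k, rfl⟩ : ∃ k', k = k' + 1 := Nat.exists_eq_succ_of_ne_zero <| by
    rintro rfl
    exact hk hb0
  have hfac : ∀ j, ∃ g : Polynomial ℂ, j < k + 1 → b j = (Polynomial.X - Polynomial.C z₀) * g := by
    intro j
    by_cases hj : j < k + 1
    · obtain ⟨g, hg⟩ := Polynomial.dvd_iff_isRoot.2 (hmin j hj)
      exact ⟨g, fun _ => hg⟩
    · exact ⟨0, fun h => absurd h hj⟩
  choose g hg using hfac
  have hg0 : (g 0).eval z₀ ≠ 0 := by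
    have h := hsimple (by simpa [hb] using hb0)
    have h0 := hg 0 (Nat.succ_pos k)
    simp only [hb, Nat.sub_zero] at h0
    simpa [h0] using h
  obtain ⟨n, hn⟩ : ∃ n, m + 1 = (k + 1) + (n + 1) := ⟨m - (k + 1), by omega⟩
  have hsplit : ∀ (τ : ℕ → ι → ℂ) (T : ℕ → ℂ), (∀ j, Tendsto (τ j) l (𝓝 (T j))) →
      (∀ᶠ i in l, ∑ j ∈ Finset.range (m + 1), (b j).eval (z i) * τ j i * (w i)⁻¹ ^ j = 0) →
      ∃ A B : ι → ℂ, Tendsto A l (𝓝 ((g 0).eval z₀ * T 0)) ∧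
        Tendsto B l (𝓝 ((b (k + 1)).eval z₀ * T (k + 1))) ∧
        ∀ᶠ i in l, (z i - z₀) * A i + (w i)⁻¹ ^ (k + 1) * B i = 0 := by
    intro τ T hτ h
    refine ⟨_, _, tendsto_sum_range_mul_pow (n := k)
      (fun j => (((g j).continuous.tendsto z₀).comp hz).mul (hτ j)) hinv,
      tendsto_sum_range_mul_pow (n := n) (a := fun j => (b (k + 1 + j)).eval z₀ * T (k + 1 + j))
      (fun j => (hbz (k + 1 + j)).mul (hτ (k + 1 + j))) hinv, ?_⟩
    filter_upwards [h] with i hi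
    rw [hn, Finset.sum_range_add] at hi
    rw [← hi, Finset.mul_sum, Finset.mul_sum]
    congr 1
    · refine Finset.sum_congr rfl fun j hj => ?_
      rw [hg j (Finset.mem_range.1 hj)]
      simp only [Polynomial.eval_mul, Polynomial.eval_sub, Polynomial.eval_X, Polynomial.eval_C,
        Function.comp_apply]
      ring
    · refine Finset.sum_congr rfl fun j _ => ?_
      rw [pow_add]
      ring
  obtain ⟨A, B, hA, hB, hAB⟩ := hsplit (fun _ _ => 1) (fun _ => 1)
    (fun _ => tendsto_const_nhds) hE
  obtain ⟨A', B', hA', hB', hAB'⟩ := hsplit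
    (fun j i => ∑ k ∈ Finset.range (m - j), (w' i / w i) ^ k) (fun j => ((m - j : ℕ) : ℂ))
    (fun j => tendsto_geom_sum_one hs _) hE'
  have hdet := (hB.mul hA').sub (hB'.mul hA)
  have hdet0 : ∀ᶠ i in l, B i * A' i - B' i * A i = 0 := by
    filter_upwards [hAB, hAB', hw0] with i h1 h2 hwi
    refine (mul_eq_zero.1 ?_).resolve_left (pow_ne_zero (k + 1) (inv_ne_zero hwi))
    linear_combination A' i * h1 - A i * h2
  have := tendsto_nhds_unique hdet (tendsto_const_nhds.congr' (hdet0.mono fun i hi => hi.symm))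
  rw [Nat.cast_sub hkm, Nat.sub_zero] at this
  have h2 : (b (k + 1)).eval z₀ * (g 0).eval z₀ * ((k + 1 : ℕ) : ℂ) = 0 := by
    linear_combination this
  exact mul_ne_zero (mul_ne_zero hk hg0) (Nat.cast_ne_zero.2 (Nat.succ_ne_zero k)) h2

theorem natDegree_fiberPoly_le {ℓ m : ℕ} (hΔ : NewtonBetween f ℓ m) (ξ : ℂ) :
    (fiberPoly f ξ).natDegree ≤ m := by
  rw [Polynomial.natDegree_le_iff_coeff_eq_zero]
  intro j hj
  rw [coeff_fiberPoly f ξ (by omega), coeff_toBivariate, Finset.sum_eq_zero]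
  intro d hd
  rw [Finset.mem_filter] at hd
  have := (hΔ.le_of_mem_support hd.1).2
  omega

theorem tendsto_div_one_of_tendsto_sub_div {ι : Type*} {l : Filter ι} {w w' : ι → ℂ}
    (hw : ∀ᶠ i in l, w i ≠ 0) (h : Tendsto (fun i => ‖w i - w' i‖ / ‖w i‖) l (𝓝 0)) :
    Tendsto (fun i => w' i / w i) l (𝓝 1) := by
  have h0 : Tendsto (fun i => (w i - w' i) / w i) l (𝓝 0) := by
    rw [tendsto_zero_iff_norm_tendsto_zero]
    simpa only [norm_div] using h
  have h1 := h0.const_sub 1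
  rw [sub_zero] at h1
  refine h1.congr' ?_
  filter_upwards [hw] with i hi
  field_simp
  ring

/-- Distinct points of a regular fiber over the same `z` are far apart as `w → ∞`. -/
theorem WeaklyNondegenerate.exists_le_norm_sub_of_norm_snd (hnd : WeaklyNondegenerate f) {ℓ m : ℕ}
    (hℓ : 1 ≤ ℓ) (hm : 1 ≤ m) (hΔ : NewtonBetween f ℓ m) {ξ : ℂ} (hξ : ξ ∉ criticalValues f)
    (K : ℝ) : ∃ R : ℝ, ∀ z w w', (fiberPoly f ξ).evalEval z w = 0 →
      (fiberPoly f ξ).evalEval z w' = 0 → w ≠ w' → R ≤ ‖w‖ → K ≤ ‖w - w'‖ := by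
  by_contra! h
  choose z w w' hP hQ hne hw hK using fun n : ℕ => h n
  have hK0 : 0 < K := (norm_nonneg _).trans_lt (hK 0)
  set l := hyperfilter ℕ
  have hwinf : Tendsto (fun n => ‖w n‖) l atTop :=
    (tendsto_atTop_mono hw tendsto_natCast_atTop_atTop).mono_left Nat.hyperfilter_le_atTop
  have hw0 : ∀ᶠ n in l, w n ≠ 0 := by
    filter_upwards [hwinf.eventually_gt_atTop 0] with i hi using norm_pos_iff.1 hi
  have hs : Tendsto (fun n => w' n / w n) l (𝓝 1) := by
    refine tendsto_div_one_of_tendsto_sub_div hw0 ?_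
    refine squeeze_zero (fun n => by positivity) (fun n => ?_) (hwinf.const_div_atTop K)
    exact div_le_div_of_nonneg_right (hK n).le (norm_nonneg _)
  by_cases hz : ∃ C, ∀ᶠ n in l, ‖z n‖ ≤ C
  · obtain ⟨C, hC⟩ := hz
    obtain ⟨z₀, hz₀⟩ := l.exists_tendsto_of_norm_le hC
    refine not_tendsto_div_of_tendsto_nhds (natDegree_fiberPoly_le hΔ ξ) (fun h0 => ?_)
      (map_fiberPoly_ne_zero hnd hm hΔ hξ z₀) l hz₀ hwinf hs (Eventually.of_forall hne)
      (Eventually.of_forall hP) (Eventually.of_forall hQ)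
    rw [coeff_fiberPoly f ξ hm] at h0 ⊢
    exact hnd.eval_derivative_top_coeff_ne_zero hm hΔ h0
  · have hzinf : Tendsto (fun n => ‖z n‖) l atTop := by
      refine tendsto_atTop.2 fun C => ?_
      have := Ultrafilter.eventually_not.2 fun hC => hz ⟨C, hC⟩
      exact this.mono fun n hn => (not_le.1 hn).le
    refine hnd.not_tendsto_div_of_tendsto_atTop hℓ hΔ (ξ := ξ) l hzinf hw0 hs
      (Eventually.of_forall hne) (Eventually.of_forall fun n => ?_)
      (Eventually.of_forall fun n => ?_)
    · rw [← sub_eq_zero, ← evalEval_fiberPoly, hP]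
    · rw [← sub_eq_zero, ← evalEval_fiberPoly, hQ]

/-- The fibers of `f` stay away from the `z`-axis as `z → ∞`. -/
theorem NewtonBetween.not_tendsto_zero_of_tendsto_atTop {ℓ m : ℕ} (hℓ : 1 ≤ ℓ)
    (hΔ : NewtonBetween f ℓ m) {ξ : ℂ} {ι : Type*} {l : Filter ι} [l.NeBot] {z w : ι → ℂ}
    (hz : Tendsto (fun i => ‖z i‖) l atTop) (hw : Tendsto w l (𝓝 0))
    (hF : ∀ᶠ i in l, MvPolynomial.eval ![z i, w i] f = ξ) : False := by
  have hinv : Tendsto (fun i => (z i)⁻¹) l (𝓝 0) :=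
    tendsto_inv₀_cobounded.comp (tendsto_norm_atTop_iff_cobounded.1 hz)
  have hmem := hΔ.single_zero_mem_support
  have hlim : Tendsto (fun i => ∑ d ∈ f.support,
      MvPolynomial.coeff d f * ((z i)⁻¹ ^ (ℓ - d 0) * w i ^ d 1)) l
      (𝓝 (∑ d ∈ f.support, MvPolynomial.coeff d f * (0 ^ (ℓ - d 0) * 0 ^ d 1))) :=
    tendsto_finsetSum _ fun d _ => ((hinv.pow _).mul (hw.pow _)).const_mul _
  have hlim' := (hinv.pow ℓ).const_mul ξ
  rw [zero_pow (by omega), mul_zero] at hlim'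
  have hzero : ∑ d ∈ f.support, MvPolynomial.coeff d f * ((0 : ℂ) ^ (ℓ - d 0) * 0 ^ d 1) = 0 := by
    refine tendsto_nhds_unique hlim (hlim'.congr' ?_)
    filter_upwards [hF, hz.eventually_gt_atTop 0] with i hi hzi
    have hzi : z i ≠ 0 := norm_pos_iff.1 hzi
    rw [← hi, eval_eq_sum_support, Finset.sum_mul]
    refine Finset.sum_congr rfl fun d hd => ?_
    rw [inv_pow, inv_pow, pow_sub₀ _ hzi (hΔ.le_of_mem_support hd).1]
    field_simp
  rw [Finset.sum_eq_single (Finsupp.single 0 ℓ) ?_ fun h => absurd hmem h] at hzero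
  · exact MvPolynomial.mem_support_iff.1 hmem (by simpa using hzero)
  · intro d hd hne
    have hle := (hΔ.le_of_mem_support hd).1
    by_cases h1 : d 1 = 0
    · have h0 : d 0 ≠ ℓ := by
        intro h0
        refine hne (Finsupp.ext fun i => ?_)
        fin_cases i <;> simp [h0, h1]
      rw [zero_pow (by omega : ℓ - d 0 ≠ 0), zero_mul, mul_zero]
    · rw [zero_pow h1, mul_zero, mul_zero]

/-- Distinct points of a fiber over the same `z` stay apart as `z → ∞`. -/
theorem WeaklyNondegenerate.exists_le_norm_sub_of_norm_fst (hnd : WeaklyNondegenerate f) {ℓ m : ℕ}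
    (hℓ : 1 ≤ ℓ) (hΔ : NewtonBetween f ℓ m) (ξ : ℂ) :
    ∃ R δ : ℝ, 0 < δ ∧ ∀ z w w', (fiberPoly f ξ).evalEval z w = 0 →
      (fiberPoly f ξ).evalEval z w' = 0 → w ≠ w' → R ≤ ‖z‖ → δ ≤ ‖w - w'‖ := by
  by_contra! h
  choose z w w' hP hP' hne hz hδ using fun n : ℕ => h n (1 / ((n : ℝ) + 1)) (by positivity)
  set l := hyperfilter ℕ
  have hzinf : Tendsto (fun n => ‖z n‖) l atTop :=
    (tendsto_atTop_mono hz tendsto_natCast_atTop_atTop).mono_left Nat.hyperfilter_le_atTop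
  have hF : ∀ᶠ n in l, MvPolynomial.eval ![z n, w n] f = ξ := Eventually.of_forall fun n => by
    rw [← sub_eq_zero, ← evalEval_fiberPoly, hP]
  have hF' : ∀ᶠ n in l, MvPolynomial.eval ![z n, w' n] f = ξ := Eventually.of_forall fun n => by
    rw [← sub_eq_zero, ← evalEval_fiberPoly, hP']
  by_cases hw : ∃ ε > 0, ∀ᶠ n in l, ε ≤ ‖w n‖
  · obtain ⟨ε, hε, hw⟩ := hw
    have hw0 : ∀ᶠ n in l, w n ≠ 0 := by
      filter_upwards [hw] with n hn using norm_pos_iff.1 (hε.trans_le hn)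
    have hδ0 : Tendsto (fun n : ℕ => 1 / ((n : ℝ) + 1) / ε) l (𝓝 0) := by
      have := (tendsto_one_div_add_atTop_nhds_zero_nat (𝕜 := ℝ)).div_const ε
      rw [zero_div] at this
      exact this.mono_left Nat.hyperfilter_le_atTop
    refine hnd.not_tendsto_div_of_tendsto_atTop hℓ hΔ l hzinf hw0
      (tendsto_div_one_of_tendsto_sub_div hw0 ?_) (Eventually.of_forall hne) hF hF'
    refine squeeze_zero' (Eventually.of_forall fun n => by positivity) ?_ hδ0
    filter_upwards [hw] with n hn
    exact div_le_div₀ (by positivity) (hδ n).le hε hn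
  · refine hΔ.not_tendsto_zero_of_tendsto_atTop hℓ (l := (l : Filter ℕ)) hzinf ?_ hF
    rw [tendsto_zero_iff_norm_tendsto_zero, Metric.tendsto_nhds]
    intro ε hε
    have := Ultrafilter.eventually_not.2 fun hC => hw ⟨ε, hε, hC⟩
    refine this.mono fun n hn => ?_
    rw [dist_zero_right, norm_norm]
    exact not_le.1 hn

/-- Almost every line parallel to the `z`-axis meets every fiber. -/
theorem NewtonBetween.exists_eval_eq {ℓ m : ℕ} (hℓ : 1 ≤ ℓ) (hΔ : NewtonBetween f ℓ m) (ξ : ℂ) :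
    ∃ q : Polynomial ℂ, q ≠ 0 ∧ ∀ w, q.eval w ≠ 0 → ∃ z, (fiberPoly f ξ).evalEval z w = 0 := by
  have hmem := hΔ.single_zero_mem_support
  refine ⟨∑ d ∈ f.support with d 0 = ℓ,
    Polynomial.C (MvPolynomial.coeff d f) * Polynomial.X ^ d 1, ?_, fun w hw => ?_⟩
  · intro h
    have := congrArg (Polynomial.coeff · 0) h
    simp only [Polynomial.finsetSum_coeff, Polynomial.coeff_C_mul_X_pow] at this
    rw [Finset.sum_eq_single (Finsupp.single 0 ℓ)] at this
    · exact MvPolynomial.mem_support_iff.1 hmem (by simpa using this)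
    · intro d hd hne
      rw [if_neg]
      intro h1
      refine hne (Finsupp.ext fun i => ?_)
      fin_cases i <;> simp [(Finset.mem_filter.1 hd).2, ← h1]
    · intro h
      exact absurd (Finset.mem_filter.2 ⟨hmem, by simp⟩) h
  · set p : Polynomial ℂ := ∑ d ∈ f.support,
      Polynomial.C (MvPolynomial.coeff d f * w ^ d 1) * Polynomial.X ^ d 0 - Polynomial.C ξ with hp
    have hcoeff : p.coeff ℓ ≠ 0 := by
      rw [hp, Polynomial.coeff_sub, Polynomial.coeff_C_of_ne_zero (by omega), sub_zero]
      simp only [Polynomial.finsetSum_coeff, Polynomial.coeff_C_mul_X_pow]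
      rw [Polynomial.eval_finsetSum, Finset.sum_filter] at hw
      convert hw using 3 with d
      · exact eq_comm
      · simp
    have hdeg : p.degree ≠ 0 := by
      intro h0
      exact hcoeff (Polynomial.coeff_eq_zero_of_degree_lt
        (h0.trans_lt (by exact_mod_cast hℓ)))
    obtain ⟨z, hz⟩ := IsAlgClosed.exists_root p hdeg
    refine ⟨z, ?_⟩
    rw [evalEval_fiberPoly, eval_eq_sum_support, ← hz, hp]
    simp only [Polynomial.eval_sub, Polynomial.eval_finsetSum, Polynomial.eval_mul,
      Polynomial.eval_C, Polynomial.eval_pow, Polynomial.eval_X]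
    congr 1
    exact Finset.sum_congr rfl fun d _ => by ring

end NewtonPolygon

/-- If `f` is weakly nondegenerate with respect to its Newton polygon,
`conv{(0,0),(ℓ,0),(0,m)} ⊆ Δ_f ⊆ [0,ℓ]×[0,m]` for some `ℓ,m ≥ 1`, and the number of
integer points in the interior of `Δ_f` is positive, then for every regular value `ξ`
the fiber `T_ξ` is nonempty and connected. -/
theorem regular_fiber_isConnected (f : MvPolynomial (Fin 2) ℂ)
    (hnd : WeaklyNondegenerate f) (ℓ m : ℕ) (hℓ : 1 ≤ ℓ) (hm : 1 ≤ m)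
    (hΔ : NewtonBetween f ℓ m) (hg : 0 < interiorIntPoints f)
    (ξ : ℂ) (hξ : ξ ∉ criticalValues f) :
    IsConnected {p : Fin 2 → ℂ | eval p f = ξ} := by
  have h0 := map_fiberPoly_ne_zero hnd hm hΔ hξ
  have hesc := hΔ.exists_eval_eq hℓ ξ
  have hset : {p : Fin 2 → ℂ | eval p f = ξ} =
      (fun p : ℂ × ℂ => ![p.1, p.2]) '' {p | (fiberPoly f ξ).evalEval p.1 p.2 = 0} := by
    ext p
    constructor
    · intro hp
      have hp' : ![p 0, p 1] = p := by
        ext i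
        fin_cases i <;> rfl
      refine ⟨(p 0, p 1), ?_, hp'⟩
      rw [Set.mem_ofPred_eq, evalEval_fiberPoly, hp', sub_eq_zero]
      exact hp
    · rintro ⟨q, hq, rfl⟩
      rwa [Set.mem_ofPred_eq, evalEval_fiberPoly, sub_eq_zero] at hq
  rw [hset]
  constructor
  · obtain ⟨q, hq, hroot⟩ := hesc
    obtain ⟨w, hw⟩ : ∃ w, q.eval w ≠ 0 := by
      by_contra! hall
      exact hq (Polynomial.funext fun w => by rw [hall w, Polynomial.eval_zero])
    obtain ⟨z, hz⟩ := hroot w hw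
    exact ⟨_, (z, w), hz, rfl⟩
  · refine (isPreconnected_zeroLocus _ h0 (exists_simple_roots_fiberPoly hξ fun h => h0 0 ?_)
      (hnd.exists_le_norm_sub_of_norm_snd hℓ hm hΔ hξ)
      (hnd.exists_le_norm_sub_of_norm_fst hℓ hΔ ξ) hesc).image _ ?_
    · rw [h, Polynomial.map_zero]
    · refine Continuous.continuousOn (continuous_pi fun i => ?_)
      fin_cases i
      · exact continuous_fst
      · exact continuous_snd
end

section
/- Let f ∈ ℂ[z,w] be weakly nondegenerate with respect to its Newton polygon Δ_f, and suppose conv{(0,0),(ℓ,0),(0,m)} ⊆ Δ_f ⊆ [0,ℓ]×[0,m] for some integers ℓ,m ≥ 1, and that the number g of integer points in the interior of Δ_f is positive. Then the restriction of f to ℂ² ∖ f⁻¹(Cr_f) is a topologically locally trivial fibration over ℂ ∖ Cr_f: for every ξ₀ ∈ ℂ ∖ Cr_f there exist an open neighbourhood V ⊆ ℂ ∖ Cr_f of ξ₀ and a homeomorphism h : f⁻¹(V) → V × f⁻¹(ξ₀) such that pr₁ ∘ h = f on f⁻¹(V). -/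
open MvPolynomial

section Flow

open Set Metric Filter Topology
open scoped NNReal

variable {E : Type*} [NormedAddCommGroup E] [NormedSpace ℂ E]

/-- `γ` solves `γ' = u • Y(γ)` on the time interval `[0,1]`. -/
def IsUnitTimeSolution (Y : E → E) (u : ℂ) (γ : ℝ → E) : Prop :=
  ∀ t ∈ Icc (0 : ℝ) 1, HasDerivWithinAt γ (u • Y (γ t)) (Icc 0 1) t

namespace IsUnitTimeSolution

variable {Y : E → E} {u u' : ℂ} {γ γ' : ℝ → E}

lemma continuousOn (h : IsUnitTimeSolution Y u γ) : ContinuousOn γ (Icc 0 1) :=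
  fun t ht => (h t ht).continuousWithinAt

lemma reverse (h : IsUnitTimeSolution Y u γ) :
    IsUnitTimeSolution Y (-u) (fun t => γ (1 - t)) := by
  intro t ht
  have ht' : 1 - t ∈ Icc (0 : ℝ) 1 := ⟨by linarith [ht.2], by linarith [ht.1]⟩
  have hd : HasDerivWithinAt (fun t : ℝ => 1 - t) (-1) (Icc 0 1) t :=
    ((hasDerivAt_id t).const_sub 1).hasDerivWithinAt
  have := (h (1 - t) ht').scomp t hd (fun s hs => ⟨by linarith [hs.2], by linarith [hs.1]⟩)
  simpa [Function.comp_def] using this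

lemma norm_sub_le {K : ℝ} (hK : ∀ x, ‖Y x‖ ≤ K) (h : IsUnitTimeSolution Y u γ)
    {t : ℝ} (ht : t ∈ Icc (0 : ℝ) 1) : ‖γ t - γ 0‖ ≤ ‖u‖ * K := by
  have h1 := Convex.norm_image_sub_le_of_norm_hasDerivWithin_le (C := ‖u‖ * K) h
    (fun s _ => by rw [norm_smul]; gcongr; exact hK _) (convex_Icc 0 1)
    (left_mem_Icc.2 zero_le_one) ht
  have h2 : ‖t - 0‖ ≤ 1 := by
    rw [sub_zero, Real.norm_eq_abs, abs_of_nonneg ht.1]; exact ht.2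
  have h3 : 0 ≤ ‖u‖ * K := mul_nonneg (norm_nonneg _) ((norm_nonneg _).trans (hK 0))
  exact h1.trans (mul_le_of_le_one_right h3 h2)

lemma dist_le_gronwallBound {K R : ℝ} {L : ℝ≥0} (hK : ∀ x, ‖Y x‖ ≤ K)
    (hL : LipschitzOnWith L Y (closedBall 0 (R + R * K)))
    (h : IsUnitTimeSolution Y u γ) (h' : IsUnitTimeSolution Y u' γ')
    (hu : ‖u‖ ≤ R) (hu' : ‖u'‖ ≤ R) (h0 : ‖γ 0‖ ≤ R) (h0' : ‖γ' 0‖ ≤ R) :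
    dist (γ 1) (γ' 1) ≤
      gronwallBound (dist (γ 0) (γ' 0)) (‖u‖₊ * L + 1 : ℝ≥0) (‖u - u'‖ * K) 1 := by
  have hK0 : 0 ≤ K := (norm_nonneg _).trans (hK 0)
  have hmem : ∀ {u : ℂ} {γ : ℝ → E}, IsUnitTimeSolution Y u γ → ‖u‖ ≤ R → ‖γ 0‖ ≤ R →
      ∀ t ∈ Ico (0 : ℝ) 1, γ t ∈ closedBall (0 : E) (R + R * K) := by
    intro u γ h hu h0 t ht
    rw [mem_closedBall_zero_iff]
    have h1 := h.norm_sub_le hK (Ico_subset_Icc_self ht)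
    have h2 : ‖u‖ * K ≤ R * K := by gcongr
    have h3 : ‖γ t‖ ≤ ‖γ t - γ 0‖ + ‖γ 0‖ := by simpa using norm_add_le (γ t - γ 0) (γ 0)
    linarith
  have hright : ∀ {u : ℂ} {γ : ℝ → E}, IsUnitTimeSolution Y u γ →
      ∀ t ∈ Ico (0 : ℝ) 1, HasDerivWithinAt γ (u • Y (γ t)) (Ici t) t := fun h t ht =>
    (h t (Ico_subset_Icc_self ht)).mono_of_mem_nhdsWithin (Icc_mem_nhdsGE_of_mem ht)
  have hlip : ∀ t ∈ Ico (0 : ℝ) 1, LipschitzOnWith (‖u‖₊ * L + 1)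
      (fun x => u • Y x) (closedBall 0 (R + R * K)) := by
    intro t _
    refine LipschitzOnWith.of_dist_le_mul fun x hx y hy => ?_
    have := hL.dist_le_mul x hx y hy
    rw [dist_smul₀]
    push_cast
    have h2 : ‖u‖ * dist (Y x) (Y y) ≤ ‖u‖ * (L * dist x y) := by gcongr
    have h3 : 0 ≤ dist x y := dist_nonneg
    linarith
  have := dist_le_of_approx_trajectories_ODE_of_mem (v := fun _ x => u • Y x)
    (εf := 0) (εg := ‖u - u'‖ * K) hlip h.continuousOn (hright h) (fun t _ => by simp)
    (hmem h hu h0) h'.continuousOn (hright h') (fun t _ => by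
      rw [dist_eq_norm, ← sub_smul, norm_smul, norm_sub_rev]
      gcongr
      exact hK _) (hmem h' hu' h0') le_rfl 1 (right_mem_Icc.2 zero_le_one)
  simpa using this

variable [ProperSpace E]

lemma eq_of_eq_zero {K : ℝ} (hY : LocallyLipschitz Y) (hK : ∀ x, ‖Y x‖ ≤ K)
    (h : IsUnitTimeSolution Y u γ) (h' : IsUnitTimeSolution Y u γ') (h0 : γ 0 = γ' 0) :
    γ 1 = γ' 1 := by
  set R := max ‖u‖ ‖γ 0‖
  obtain ⟨L, hL⟩ := hY.locallyLipschitzOn.exists_lipschitzOnWith_of_compact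
    (isCompact_closedBall (0 : E) (R + R * K))
  have := dist_le_gronwallBound hK hL h h' (le_max_left _ _) (le_max_left _ _) (le_max_right _ _)
    (h0 ▸ le_max_right _ _)
  rw [h0, dist_self, sub_self, norm_zero, zero_mul, gronwallBound_ε0, zero_mul] at this
  exact dist_le_zero.1 this

lemma exists_solution {K : ℝ} (hY : LocallyLipschitz Y) (hK : ∀ x, ‖Y x‖ ≤ K) (p : E) (u : ℂ) :
    ∃ γ, γ 0 = p ∧ IsUnitTimeSolution Y u γ := by
  have : CompleteSpace E := inferInstance
  have hK0 : 0 ≤ K := (norm_nonneg _).trans (hK 0)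
  lift K to ℝ≥0 using hK0
  obtain ⟨L, hL⟩ := hY.locallyLipschitzOn.exists_lipschitzOnWith_of_compact
    (isCompact_closedBall p ((‖u‖₊ * K : ℝ≥0) : ℝ))
  have hP : IsPicardLindelof (fun _ x => u • Y x) (tmin := 0) (tmax := 1)
      ⟨0, left_mem_Icc.2 zero_le_one⟩ p (‖u‖₊ * K) 0 (‖u‖₊ * K) (‖u‖₊ * L) := by
    refine IsPicardLindelof.of_time_independent (fun x _ => ?_) ?_ (by simp)
    · rw [norm_smul]; push_cast; gcongr; exact hK _
    · refine LipschitzOnWith.of_dist_le_mul fun x hx y hy => ?_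
      have := hL.dist_le_mul x hx y hy
      rw [dist_smul₀]
      push_cast
      rw [mul_assoc]
      gcongr
  exact hP.exists_eq_forall_mem_Icc_hasDerivWithinAt₀

end IsUnitTimeSolution

open IsUnitTimeSolution

variable [ProperSpace E]

lemma continuous_endpoint {Y : E → E} {K : ℝ} (hY : LocallyLipschitz Y) (hK : ∀ x, ‖Y x‖ ≤ K)
    {Φ : E → ℂ → ℝ → E} (h0 : ∀ p u, Φ p u 0 = p) (h : ∀ p u, IsUnitTimeSolution Y u (Φ p u)) :
    Continuous fun q : E × ℂ => Φ q.1 q.2 1 := by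
  rw [continuous_iff_continuousAt]
  rintro ⟨p, u⟩
  set R := max ‖u‖ ‖p‖ + 1
  obtain ⟨L, hL⟩ := hY.locallyLipschitzOn.exists_lipschitzOnWith_of_compact
    (isCompact_closedBall (0 : E) (R + R * K))
  have hu : ‖u‖ < R := (le_max_left _ _).trans_lt (lt_add_one _)
  have hp : ‖p‖ < R := (le_max_right _ _).trans_lt (lt_add_one _)
  have hbound : ∀ᶠ q : E × ℂ in 𝓝 (p, u), dist (Φ q.1 q.2 1) (Φ p u 1) ≤
      gronwallBound (dist p q.1) (‖u‖₊ * L + 1 : ℝ≥0) (‖u - q.2‖ * K) 1 := by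
    have e1 : ∀ᶠ q : E × ℂ in 𝓝 (p, u), ‖q.1‖ < R :=
      (continuous_fst.norm.continuousAt (x := (p, u))).eventually_lt_const hp
    have e2 : ∀ᶠ q : E × ℂ in 𝓝 (p, u), ‖q.2‖ < R :=
      (continuous_snd.norm.continuousAt (x := (p, u))).eventually_lt_const hu
    filter_upwards [e1, e2] with q h1 h2
    have := dist_le_gronwallBound hK hL (h p u) (h q.1 q.2) hu.le h2.le (by rw [h0]; exact hp.le)
      (by rw [h0]; exact h1.le)
    rw [dist_comm]
    simpa only [h0] using this
  refine tendsto_iff_dist_tendsto_zero.2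
    (squeeze_zero' (Eventually.of_forall fun _ => dist_nonneg) hbound ?_)
  have hne : ((‖u‖₊ * L + 1 : ℝ≥0) : ℝ) ≠ 0 := by positivity
  simp only [gronwallBound_of_K_ne_0 hne]
  refine Continuous.tendsto' (by fun_prop) (p, u) 0 (by simp)

/-- Integrating a bounded, locally Lipschitz vector field `Y` that lifts the constant field `1`
over a disc trivializes `F` over that disc. -/
theorem exists_homeomorph_of_lift {F : E → ℂ} {F' : E → E →L[ℂ] ℂ} {Y : E → E} {g : E → ℝ}
    {K r : ℝ} (hY : LocallyLipschitz Y) (hK : ∀ x, ‖Y x‖ ≤ K)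
    (hF : ∀ x, HasFDerivAt F (F' x) x) (hFY : ∀ x, F' x (Y x) = g x)
    (hg : Continuous g) (hg0 : ∀ x, 0 ≤ g x) (hg1 : ∀ x, g x ≤ 1) (ξ₀ : ℂ)
    (hgV : ∀ x, F x ∈ ball ξ₀ r → g x = 1) (hr : 0 < r) :
    ∃ h : {p : E // F p ∈ ball ξ₀ r} ≃ₜ (ball ξ₀ r × {p : E // F p = ξ₀}),
      ∀ p, ((h p).1 : ℂ) = F p.val := by
  choose Φ h0 hΦ using fun p u => exists_solution hY hK p u
  have hcont := continuous_endpoint hY hK h0 hΦ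
  have hFc : Continuous F := continuous_iff_continuousAt.2 fun x => (hF x).continuousAt
  have hinv : ∀ p u, Φ (Φ p u 1) (-u) 1 = p := by
    intro p u
    have := eq_of_eq_zero hY hK (hΦ (Φ p u 1) (-u)) (hΦ p u).reverse (by simp [h0])
    simpa [h0] using this
  have hval : ∀ p u, F p ∈ ball ξ₀ r → F p + u ∈ ball ξ₀ r → F (Φ p u 1) = F p + u := by
    intro p u hp hpu
    have hd : ∀ t ∈ Icc (0 : ℝ) 1,
        HasDerivWithinAt (fun t => F (Φ p u t)) (u * g (Φ p u t)) (Icc 0 1) t := by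
      intro t ht
      have := ((hF (Φ p u t)).restrictScalars ℝ).comp_hasDerivWithinAt t (hΦ p u t ht)
      simpa [hFY, Function.comp_def] using this
    have hgc : ContinuousOn (fun t => g (Φ p u t)) (Icc 0 1) :=
      hg.comp_continuousOn (hΦ p u).continuousOn
    have hint : ∀ t ∈ Icc (0 : ℝ) 1,
        F (Φ p u t) - F p = u * ((∫ s in (0 : ℝ)..t, g (Φ p u s) : ℝ) : ℂ) := by
      intro t ht
      have hsub : Icc 0 t ⊆ Icc (0 : ℝ) 1 := Icc_subset_Icc_right ht.2
      have := intervalIntegral.integral_eq_sub_of_hasDeriv_right_of_le ht.1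
        (f := fun t => F (Φ p u t)) (f' := fun t => u * g (Φ p u t))
        (fun s hs => (hd s (hsub hs)).continuousWithinAt.mono hsub)
        (fun s hs => (hd s (hsub (Ioo_subset_Icc_self hs))).mono_of_mem_nhdsWithin
          (mem_nhdsWithin_of_mem_nhds (Icc_mem_nhds hs.1 (hs.2.trans_le ht.2))))
        (ContinuousOn.intervalIntegrable (by
          rw [uIcc_of_le ht.1]
          exact continuousOn_const.mul
            (Complex.continuous_ofReal.comp_continuousOn (hgc.mono hsub))))
      rw [intervalIntegral.integral_const_mul, intervalIntegral.integral_ofReal] at this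
      rw [this, h0]
    have hone : ∀ t ∈ Icc (0 : ℝ) 1, g (Φ p u t) = 1 := by
      intro t ht
      apply hgV
      have hsub : Icc 0 t ⊆ Icc (0 : ℝ) 1 := Icc_subset_Icc_right ht.2
      have hii : IntervalIntegrable (fun s => g (Φ p u s)) MeasureTheory.volume 0 t :=
        ContinuousOn.intervalIntegrable (by rw [uIcc_of_le ht.1]; exact hgc.mono hsub)
      have hs0 : 0 ≤ ∫ s in (0 : ℝ)..t, g (Φ p u s) :=
        intervalIntegral.integral_nonneg ht.1 fun s _ => hg0 _
      have hs1 : ∫ s in (0 : ℝ)..t, g (Φ p u s) ≤ 1 := by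
        have := intervalIntegral.integral_mono_on ht.1 hii
          (intervalIntegrable_const (c := (1 : ℝ))) fun s _ => hg1 _
        simp at this
        linarith [ht.2]
      have hconv := (convex_ball ξ₀ r).add_smul_mem hp hpu ⟨hs0, hs1⟩
      have heq := hint t ht
      rw [show F (Φ p u t) = F p + (∫ s in (0 : ℝ)..t, g (Φ p u s) : ℝ) • u by
        rw [Complex.real_smul, mul_comm, ← heq]; ring]
      exact hconv
    have h1 := hint 1 (right_mem_Icc.2 zero_le_one)
    rw [intervalIntegral.integral_congr (g := fun _ => (1 : ℝ)) (fun s hs => hone s (by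
      rwa [uIcc_of_le zero_le_one] at hs))] at h1
    simp at h1
    linear_combination h1
  have hξ : ξ₀ ∈ ball ξ₀ r := mem_ball_self hr
  have hsec : ∀ q : ball ξ₀ r × {p : E // F p = ξ₀}, F (Φ q.2.1 (q.1.1 - ξ₀) 1) = q.1.1 := by
    rintro ⟨⟨ξ, hξV⟩, p, hp⟩
    rw [hval _ _ (hp ▸ hξ) (by rw [hp]; simpa using hξV), hp]
    ring
  refine ⟨{
    toFun := fun p => (⟨F p.1, p.2⟩, ⟨Φ p.1 (ξ₀ - F p.1) 1, by
      rw [hval _ _ p.2 (by simpa using hξ)]; ring⟩)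
    invFun := fun q => ⟨Φ q.2.1 (q.1.1 - ξ₀) 1, (hsec q).symm ▸ q.1.2⟩
    left_inv := fun p => by
      have := hinv p.1 (ξ₀ - F p.1)
      ext1
      simpa using this
    right_inv := fun q => by
      have := hinv q.2.1 (q.1.1 - ξ₀)
      refine Prod.ext (Subtype.ext (hsec q)) (Subtype.ext ?_)
      simp only [hsec q]
      simpa using this
    continuous_toFun := by
      refine Continuous.prodMk (by fun_prop) (Continuous.subtype_mk ?_ _)
      exact hcont.comp (by fun_prop : Continuous fun p : {p : E // F p ∈ ball ξ₀ r} =>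
        (p.1, ξ₀ - F p.1))
    continuous_invFun := by
      refine Continuous.subtype_mk ?_ _
      exact hcont.comp (by fun_prop : Continuous
        fun q : ball ξ₀ r × {p : E // F p = ξ₀} => (q.2.1, q.1.1 - ξ₀)) }, fun p => rfl⟩

end Flow

section Tameness

open Set Filter Topology

/-- The value at `p` of the monomial with exponent vector `d`. -/
def monomialValue (d : Fin 2 →₀ ℕ) (p : Fin 2 → ℂ) : ℂ := p 0 ^ d 0 * p 1 ^ d 1

/-- The exponent vector `d` as a point of `ℝ²`. -/
def exponentPoint (d : Fin 2 →₀ ℕ) : ℝ × ℝ := ((d 0 : ℝ), (d 1 : ℝ))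

/-- The logarithm of the absolute value at `p` of a monomial with real exponent vector `q`. -/
noncomputable def logWeight (q : ℝ × ℝ) (p : Fin 2 → ℂ) : ℝ :=
  q.1 * Real.log ‖p 0‖ + q.2 * Real.log ‖p 1‖

lemma monomialValue_ne_zero {p : Fin 2 → ℂ} (hp : ∀ i, p i ≠ 0) (d : Fin 2 →₀ ℕ) :
    monomialValue d p ≠ 0 :=
  mul_ne_zero (pow_ne_zero _ (hp 0)) (pow_ne_zero _ (hp 1))

lemma norm_monomialValue {p : Fin 2 → ℂ} (hp : ∀ i, p i ≠ 0) (d : Fin 2 →₀ ℕ) :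
    ‖monomialValue d p‖ = Real.exp (logWeight (exponentPoint d) p) := by
  have h : ∀ i, 0 < ‖p i‖ := fun i => norm_pos_iff.2 (hp i)
  simp only [monomialValue, logWeight, exponentPoint, norm_mul, norm_pow, Real.exp_add,
    mul_comm (_ : ℝ) (Real.log _), ← Real.rpow_def_of_pos (h _), Real.rpow_natCast]

lemma eval_sum_monomial (S : Finset (Fin 2 →₀ ℕ)) (c : (Fin 2 →₀ ℕ) → ℂ) (p : Fin 2 → ℂ) :
    eval p (∑ d ∈ S, monomial d (c d)) = ∑ d ∈ S, c d * monomialValue d p := by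
  simp only [map_sum, eval_monomial, monomialValue]
  refine Finset.sum_congr rfl fun d _ => ?_
  rw [Finsupp.prod_fintype _ _ (by simp), Fin.prod_univ_two]

lemma mul_eval_pderiv_sum_monomial (S : Finset (Fin 2 →₀ ℕ)) (c : (Fin 2 →₀ ℕ) → ℂ)
    (p : Fin 2 → ℂ) (i : Fin 2) :
    p i * eval p (pderiv i (∑ d ∈ S, monomial d (c d))) =
      ∑ d ∈ S, (c d * d i) * monomialValue d p := by
  have h : X i * pderiv i (∑ d ∈ S, monomial d (c d)) = ∑ d ∈ S, monomial d (c d * d i) := by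
    rw [map_sum, Finset.mul_sum]
    refine Finset.sum_congr rfl fun d _ => ?_
    rw [X_mul_pderiv_monomial, smul_monomial, nsmul_eq_mul, mul_comm]
  rw [← eval_sum_monomial, ← h, map_mul, eval_X]

lemma isLinearMap_logWeight (p : Fin 2 → ℂ) : IsLinearMap ℝ (fun q => logWeight q p) where
  map_add x y := by simp [logWeight]; ring
  map_smul c x := by simp [logWeight]; ring

lemma logWeight_le_of_mem_newtonPolygon {f : MvPolynomial (Fin 2) ℂ} {p : Fin 2 → ℂ} {c : ℝ}
    (h : ∀ d ∈ f.support, logWeight (exponentPoint d) p ≤ c) {q : ℝ × ℝ}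
    (hq : q ∈ newtonPolygon f) : logWeight q p ≤ c := by
  refine convexHull_min ?_ (convex_halfSpace_le (isLinearMap_logWeight p) c) hq
  rintro _ ⟨d, hd, rfl⟩
  exact h d hd

/-- The part of `Δ` on which the log-weight along `p` stays within a bounded distance of the
log-weight of `q₀`. -/
def dominantFace {ι : Type*} (F : Filter ι) (p : ι → Fin 2 → ℂ) (Δ : Set (ℝ × ℝ)) (q₀ : ℝ × ℝ) :
    Set (ℝ × ℝ) :=
  {q | q ∈ Δ ∧ ∃ C, ∀ᶠ k in F, logWeight q₀ (p k) - logWeight q (p k) ≤ C}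

section DominantFace

variable {ι : Type*} {F : Filter ι} {p : ι → Fin 2 → ℂ} {Δ : Set (ℝ × ℝ)} {q₀ : ℝ × ℝ}

lemma convex_dominantFace (hΔ : Convex ℝ Δ) : Convex ℝ (dominantFace F p Δ q₀) := by
  rintro x ⟨hx, C, hC⟩ y ⟨hy, D, hD⟩ a b ha hb hab
  refine ⟨hΔ hx hy ha hb hab, a * C + b * D, ?_⟩
  filter_upwards [hC, hD] with k h1 h2
  have e : logWeight q₀ (p k) - logWeight (a • x + b • y) (p k) =
      a * (logWeight q₀ (p k) - logWeight x (p k)) +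
        b * (logWeight q₀ (p k) - logWeight y (p k)) := by
    obtain rfl : b = 1 - a := by linarith
    simp [logWeight]; ring
  rw [e]
  gcongr

lemma isExtreme_dominantFace
    (hmax : ∀ q ∈ Δ, ∀ᶠ k in F, logWeight q (p k) ≤ logWeight q₀ (p k)) :
    IsExtreme ℝ Δ (dominantFace F p Δ q₀) := by
  refine ⟨fun x hx => hx.1, ?_⟩
  rintro x hx y hy z ⟨-, C, hC⟩ ⟨a, b, ha, hb, hab, rfl⟩
  refine ⟨hx, C / a, ?_⟩
  filter_upwards [hC, hmax y hy] with k h1 h2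
  have e : logWeight q₀ (p k) - logWeight (a • x + b • y) (p k) =
      a * (logWeight q₀ (p k) - logWeight x (p k)) +
        b * (logWeight q₀ (p k) - logWeight y (p k)) := by
    obtain rfl : b = 1 - a := by linarith
    simp [logWeight]; ring
  rw [le_div_iff₀ ha]
  nlinarith [mul_nonneg hb.le (sub_nonneg.2 h2)]

/-- Differences of points of the dominant face have bounded log-weight. -/
lemma exists_abs_logWeight_sub_le
    (hmax : ∀ q ∈ Δ, ∀ᶠ k in F, logWeight q (p k) ≤ logWeight q₀ (p k)) {x : ℝ × ℝ}
    (hx : x ∈ dominantFace F p Δ q₀) : ∃ C, ∀ᶠ k in F, |logWeight (x - q₀) (p k)| ≤ C := by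
  obtain ⟨hx, C, hC⟩ := hx
  refine ⟨C, ?_⟩
  filter_upwards [hC, hmax x hx] with k h1 h2
  have e : logWeight (x - q₀) (p k) = logWeight x (p k) - logWeight q₀ (p k) := by
    simp [logWeight]; ring
  rw [e, abs_le]
  constructor <;> linarith

/-- Unless the logarithms of both coordinates stay bounded, the dominant face is contained in
a line. -/
lemma dominantFace_collinear [F.NeBot]
    (hmax : ∀ q ∈ Δ, ∀ᶠ k in F, logWeight q (p k) ≤ logWeight q₀ (p k))
    (hinf : ∀ C, ∀ᶠ k in F, C < max (Real.log ‖p k 0‖) (Real.log ‖p k 1‖)) :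
    ∃ v : ℝ × ℝ, (v = 0 ∨ q₀ + v ∈ dominantFace F p Δ q₀) ∧
      ∀ x ∈ dominantFace F p Δ q₀, ∃ t : ℝ, x = q₀ + t • v := by
  by_cases hsub : ∀ x ∈ dominantFace F p Δ q₀, x = q₀
  · exact ⟨0, Or.inl rfl, fun x hx => ⟨0, by simp [hsub x hx]⟩⟩
  push Not at hsub
  obtain ⟨y, hy, hne⟩ := hsub
  refine ⟨y - q₀, Or.inr (by simpa using hy), fun x hx => ?_⟩
  obtain ⟨C, hC⟩ := exists_abs_logWeight_sub_le hmax hx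
  obtain ⟨D, hD⟩ := exists_abs_logWeight_sub_le hmax hy
  set u := x - q₀ with hu
  set v := y - q₀ with hv
  have hv0 : v ≠ 0 := sub_ne_zero.2 hne
  have hdet : v.1 * u.2 - v.2 * u.1 = 0 := by
    by_contra hdet
    set δ := v.1 * u.2 - v.2 * u.1 with hδ
    obtain ⟨k, h1, h2, h3⟩ := (hC.and (hD.and (hinf
      (((|u.1| + |u.2|) * D + (|v.1| + |v.2|) * C) / |δ|)))).exists
    have hδ' : 0 < |δ| := abs_pos.2 hdet
    have hC0 : 0 ≤ C := (abs_nonneg _).trans h1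
    have hD0 : 0 ≤ D := (abs_nonneg _).trans h2
    have e1 : δ * Real.log ‖p k 0‖ = u.2 * logWeight v (p k) - v.2 * logWeight u (p k) := by
      simp only [hδ, logWeight]; ring
    have e2 : δ * Real.log ‖p k 1‖ = v.1 * logWeight u (p k) - u.1 * logWeight v (p k) := by
      simp only [hδ, logWeight]; ring
    have key : ∀ {a b l : ℝ}, |a| ≤ |u.1| + |u.2| → |b| ≤ |v.1| + |v.2| →
        (δ * l = a * logWeight v (p k) - b * logWeight u (p k) ∨
          δ * l = b * logWeight u (p k) - a * logWeight v (p k)) →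
        l ≤ ((|u.1| + |u.2|) * D + (|v.1| + |v.2|) * C) / |δ| := by
      intro a b l ha hb h
      rw [le_div_iff₀ hδ']
      have g1 : |a * logWeight v (p k)| ≤ (|u.1| + |u.2|) * D := by rw [abs_mul]; gcongr
      have g2 : |b * logWeight u (p k)| ≤ (|v.1| + |v.2|) * C := by rw [abs_mul]; gcongr
      have g3 : l * |δ| ≤ |δ * l| := by
        rw [abs_mul, mul_comm]; gcongr; exact le_abs_self l
      have g4 : |δ * l| ≤ |a * logWeight v (p k)| + |b * logWeight u (p k)| := by
        rcases h with h | h <;> rw [h]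
        · exact abs_sub _ _
        · rw [add_comm]; exact abs_sub _ _
      linarith
    exact absurd h3 (not_lt.2 (max_le
      (key (by linarith [abs_nonneg u.1]) (by linarith [abs_nonneg v.1]) (Or.inl e1))
      (key (by linarith [abs_nonneg u.2]) (by linarith [abs_nonneg v.2]) (Or.inr e2))))
  have hn : v.1 ^ 2 + v.2 ^ 2 ≠ 0 := by
    intro h
    apply hv0
    ext <;> simp <;> nlinarith [sq_nonneg v.1, sq_nonneg v.2]
  refine ⟨(u.1 * v.1 + u.2 * v.2) / (v.1 ^ 2 + v.2 ^ 2), ?_⟩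
  rw [← sub_eq_iff_eq_add', ← hu]
  ext
  · simp; field_simp; linear_combination (-v.2) * hdet
  · simp; field_simp; linear_combination v.1 * hdet

end DominantFace

lemma monomialValue_exp_mul (s : Fin 2 → ℝ) (θ : Fin 2 → ℂ) (d : Fin 2 →₀ ℕ) :
    monomialValue d (fun i => (Real.exp (s i) : ℂ) * θ i) =
      (Real.exp (d 0 * s 0 + d 1 * s 1) : ℂ) * monomialValue d θ := by
  simp only [monomialValue, mul_pow, Real.exp_add, Real.exp_nat_mul]
  push_cast
  ring

lemma continuous_monomialValue (d : Fin 2 →₀ ℕ) : Continuous (monomialValue d) := by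
  unfold monomialValue
  fun_prop

lemma exponentPoint_injective : Function.Injective exponentPoint := by
  intro d d' h
  simp only [exponentPoint, Prod.mk.injEq, Nat.cast_inj] at h
  ext i
  fin_cases i
  exacts [h.1, h.2]

section TorusLimit

variable {ι : Type*} {F : Ultrafilter ι} {p : ι → Fin 2 → ℂ}

/-- Along an ultrafilter, the ratios of the monomials whose exponents lie on a line along which
the log-weight is bounded converge to the corresponding ratios at a point of the torus. -/
lemma exists_torus_limit (hp : ∀ k i, p k i ≠ 0) (d₀ : Fin 2 →₀ ℕ) {v : ℝ × ℝ} {C : ℝ}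
    (hv : ∀ᶠ k in F, |logWeight v (p k)| ≤ C) :
    ∃ a : Fin 2 → ℂ, (∀ i, a i ≠ 0) ∧ ∀ (d : Fin 2 →₀ ℕ) (t : ℝ),
      exponentPoint d = exponentPoint d₀ + t • v →
      Tendsto (fun k => monomialValue d (p k) / monomialValue d₀ (p k)) F
        (𝓝 (monomialValue d a / monomialValue d₀ a)) := by
  set n := v.1 ^ 2 + v.2 ^ 2 with hn
  have hn0 : 0 ≤ n := by positivity
  set V : Fin 2 → ℝ := ![v.1, v.2] with hV
  let σ : ι → ℝ := fun k => logWeight v (p k) / n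
  let θ : ι → Fin 2 → ℂ := fun k i => p k i / ‖p k i‖
  obtain ⟨s, -, hs⟩ := (isCompact_Icc (a := -(C / n)) (b := C / n)).ultrafilter_le_nhds'
    (F.map σ) (by
      change ∀ᶠ k in (F : Filter ι), σ k ∈ Icc (-(C / n)) (C / n)
      filter_upwards [hv] with k hk
      rw [mem_Icc, ← abs_le, abs_div, abs_of_nonneg hn0]
      gcongr)
  have hθ1 : ∀ k i, ‖θ k i‖ = 1 := fun k i => by simp [θ, hp k i]
  have hθ : ∀ i, ∃ z : ℂ, z ≠ 0 ∧ Tendsto (fun k => θ k i) F (𝓝 z) := by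
    intro i
    obtain ⟨z, hz, hz'⟩ := (isCompact_sphere (0 : ℂ) 1).ultrafilter_le_nhds'
      (F.map fun k => θ k i) (Ultrafilter.mem_map.2 (Filter.univ_mem' fun k => by simp [hθ1]))
    exact ⟨z, ne_zero_of_mem_unit_sphere ⟨z, hz⟩, hz'⟩
  choose z hz0 hz using hθ
  have hs' : Tendsto σ F (𝓝 s) := hs
  have hexp : ∀ (s : Fin 2 → ℝ) i, (Real.exp (s i) : ℂ) ≠ 0 := fun s i => by
    exact_mod_cast (Real.exp_pos _).ne'
  let a : Fin 2 → ℂ := fun i => (Real.exp (s * V i) : ℂ) * z i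
  have ha : ∀ i, a i ≠ 0 := fun i => mul_ne_zero (hexp (fun i => s * V i) i) (hz0 i)
  refine ⟨a, ha, fun d t hd => ?_⟩
  let b : ι → Fin 2 → ℂ := fun k i => (Real.exp (σ k * V i) : ℂ) * θ k i
  have hb : Tendsto b F (𝓝 a) := tendsto_pi_nhds.2 fun i =>
    ((Complex.continuous_ofReal.comp Real.continuous_exp).tendsto _ |>.comp
      (hs'.mul_const (V i))).mul (hz i)
  refine (((continuous_monomialValue d).tendsto a).comp hb |>.div
    (((continuous_monomialValue d₀).tendsto a).comp hb)
    (monomialValue_ne_zero ha d₀)).congr fun k => ?_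
  have hpk : p k = fun i => (Real.exp (Real.log ‖p k i‖) : ℂ) * θ k i := by
    ext i
    have : (‖p k i‖ : ℂ) ≠ 0 := by simpa using hp k i
    rw [Real.exp_log (norm_pos_iff.2 (hp k i))]
    simp only [θ]
    field_simp
  have hθ0 : monomialValue d₀ (θ k) ≠ 0 :=
    monomialValue_ne_zero (fun i => by rw [← norm_pos_iff, hθ1]; exact one_pos) d₀
  have hσ : σ k * n = logWeight v (p k) := by
    by_cases h : n = 0
    · have h1 : v.1 = 0 := by nlinarith [sq_nonneg v.1, sq_nonneg v.2]
      have h2 : v.2 = 0 := by nlinarith [sq_nonneg v.1, sq_nonneg v.2]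
      simp [logWeight, h1, h2, h]
    · exact div_mul_cancel₀ _ h
  simp only [exponentPoint, Prod.ext_iff, Prod.fst_add, Prod.snd_add, Prod.smul_fst,
    Prod.smul_snd, smul_eq_mul] at hd
  have key : Real.exp (d 0 * (σ k * V 0) + d 1 * (σ k * V 1)) *
        Real.exp (d₀ 0 * Real.log ‖p k 0‖ + d₀ 1 * Real.log ‖p k 1‖) =
      Real.exp (d 0 * Real.log ‖p k 0‖ + d 1 * Real.log ‖p k 1‖) *
        Real.exp (d₀ 0 * (σ k * V 0) + d₀ 1 * (σ k * V 1)) := by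
    rw [← Real.exp_add, ← Real.exp_add]
    congr 1
    simp only [logWeight] at hσ
    simp only [hV, Matrix.cons_val_zero, Matrix.cons_val_one]
    rw [hd.1, hd.2]
    linear_combination t * hσ
  have key' : (Real.exp (d 0 * (σ k * V 0) + d 1 * (σ k * V 1)) : ℂ) *
        (Real.exp (d₀ 0 * Real.log ‖p k 0‖ + d₀ 1 * Real.log ‖p k 1‖) : ℂ) =
      (Real.exp (d 0 * Real.log ‖p k 0‖ + d 1 * Real.log ‖p k 1‖) : ℂ) *
        (Real.exp (d₀ 0 * (σ k * V 0) + d₀ 1 * (σ k * V 1)) : ℂ) := by exact_mod_cast key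
  have hne : ∀ x : ℝ, (Real.exp x : ℂ) ≠ 0 := fun x => hexp (fun _ => x) 0
  change monomialValue d (fun i => (Real.exp (σ k * V i) : ℂ) * θ k i) /
    monomialValue d₀ (fun i => (Real.exp (σ k * V i) : ℂ) * θ k i) = _
  conv_rhs => rw [hpk]
  rw [monomialValue_exp_mul (fun i => σ k * V i), monomialValue_exp_mul (fun i => σ k * V i),
    monomialValue_exp_mul (fun i => Real.log ‖p k i‖),
    monomialValue_exp_mul (fun i => Real.log ‖p k i‖),
    div_eq_div_iff (mul_ne_zero (hne _) hθ0) (mul_ne_zero (hne _) hθ0)]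
  linear_combination monomialValue d (θ k) * monomialValue d₀ (θ k) * key'

end TorusLimit

/-- A polynomial that is weakly nondegenerate and convenient is tame: along a family of points
of the torus that escapes to infinity while `f` stays bounded, the gradient cannot tend to `0`. -/
theorem not_tendsto_pderiv_zero {f : MvPolynomial (Fin 2) ℂ} (hnd : WeaklyNondegenerate f)
    {ℓ m : ℕ} (hℓ : 1 ≤ ℓ) (hm : 1 ≤ m) (hΔ : NewtonBetween f ℓ m) {ι : Type*}
    {F : Ultrafilter ι} {p : ι → Fin 2 → ℂ} (hp : ∀ k i, p k i ≠ 0)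
    (hinf : ∀ C, ∀ᶠ k in F, C < max (Real.log ‖p k 0‖) (Real.log ‖p k 1‖))
    {B : ℝ} (hB : ∀ᶠ k in F, ‖eval (p k) f‖ ≤ B) :
    ¬ ∀ i, Tendsto (fun k => eval (p k) (pderiv i f)) F (𝓝 0) := by
  classical
  intro hgrad
  have hmem : ∀ q ∈ ({(0, 0), ((ℓ : ℝ), 0), (0, (m : ℝ))} : Set (ℝ × ℝ)), q ∈ newtonPolygon f :=
    fun q hq => hΔ.1 (subset_convexHull ℝ _ hq)
  have hsupp : f.support.Nonempty := by
    by_contra h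
    have := hmem (0, 0) (by simp)
    simp [newtonPolygon, Finset.not_nonempty_iff_eq_empty.1 h] at this
  obtain ⟨d₀, hd₀, hmaxS⟩ : ∃ d₀ ∈ f.support, ∀ᶠ k in F, ∀ d ∈ f.support,
      logWeight (exponentPoint d) (p k) ≤ logWeight (exponentPoint d₀) (p k) := by
    have : (⋃ d₀ ∈ (f.support : Set (Fin 2 →₀ ℕ)), {k | ∀ d ∈ f.support,
        logWeight (exponentPoint d) (p k) ≤ logWeight (exponentPoint d₀) (p k)}) ∈ F := by
      refine Filter.mem_of_superset Filter.univ_mem fun k _ => ?_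
      obtain ⟨d₀, h, h'⟩ := Finset.exists_max_image f.support
        (fun d => logWeight (exponentPoint d) (p k)) hsupp
      exact mem_biUnion (Finset.mem_coe.2 h) h'
    exact (Ultrafilter.finite_biUnion_mem_iff f.support.finite_toSet).1 this
  set q₀ := exponentPoint d₀ with hq₀
  have hmaxk : ∀ᶠ k in F, ∀ q ∈ newtonPolygon f, logWeight q (p k) ≤ logWeight q₀ (p k) := by
    filter_upwards [hmaxS] with k hk q hq using logWeight_le_of_mem_newtonPolygon hk hq
  have hmax : ∀ q ∈ newtonPolygon f, ∀ᶠ k in F, logWeight q (p k) ≤ logWeight q₀ (p k) :=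
    fun q hq => hmaxk.mono fun k hk => hk q hq
  have hlog : ∀ᶠ k in F, ∀ i, Real.log ‖p k i‖ ≤ logWeight q₀ (p k) := by
    filter_upwards [hmaxk] with k hk i
    have h0 := hk (0, 0) (hmem _ (by simp))
    have h1 := hk (ℓ, 0) (hmem _ (by simp))
    have h2 := hk (0, m) (hmem _ (by simp))
    have key : ∀ {n : ℕ} {x : ℝ}, 1 ≤ n → 0 ≤ logWeight q₀ (p k) →
        n * x ≤ logWeight q₀ (p k) → x ≤ logWeight q₀ (p k) := by
      intro n x hn h0 h
      have hn' : (1 : ℝ) ≤ n := by exact_mod_cast hn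
      rcases le_total x 0 with hx | hx
      · exact hx.trans h0
      · nlinarith
    simp only [logWeight, zero_mul, add_zero, zero_add] at h0 h1 h2 key ⊢
    fin_cases i
    · exact key hℓ h0 h1
    · exact key hm h0 h2
  have hMtop : Tendsto (fun k => logWeight q₀ (p k)) F atTop := by
    refine tendsto_atTop.2 fun C => ?_
    filter_upwards [hinf C, hlog] with k h1 h2
    exact h1.le.trans (max_le (h2 0) (h2 1))
  have hnorm_top : Tendsto (fun k => ‖monomialValue d₀ (p k)‖) F atTop :=
    (Real.tendsto_exp_atTop.comp hMtop).congr fun k => (norm_monomialValue (hp k) d₀).symm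
  have hle : ∀ᶠ k in F, ∀ i, ‖p k i‖ ≤ ‖monomialValue d₀ (p k)‖ := by
    filter_upwards [hlog] with k hk i
    rw [norm_monomialValue (hp k), ← Real.exp_log (norm_pos_iff.2 (hp k i))]
    exact Real.exp_le_exp.2 (hk i)
  set e := dominantFace (F : Filter ι) p (newtonPolygon f) q₀
  have hsuppΔ : ∀ d ∈ f.support, exponentPoint d ∈ newtonPolygon f :=
    fun d hd => subset_convexHull ℝ _ ⟨d, hd, rfl⟩
  have hq₀e : q₀ ∈ e := ⟨hsuppΔ d₀ hd₀, 0, Eventually.of_forall fun k => by simp⟩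
  obtain ⟨v, hv, hline⟩ := dominantFace_collinear hmax hinf
  obtain ⟨C, hC⟩ : ∃ C, ∀ᶠ k in F, |logWeight v (p k)| ≤ C := by
    rcases hv with rfl | hv
    · exact ⟨0, Eventually.of_forall fun k => by simp [logWeight]⟩
    · simpa using exists_abs_logWeight_sub_le hmax hv
  obtain ⟨a, ha, hlim⟩ := exists_torus_limit hp d₀ hC
  have hratio : ∀ d ∈ f.support,
      Tendsto (fun k => monomialValue d (p k) / monomialValue d₀ (p k)) F
        (𝓝 (if exponentPoint d ∈ e then monomialValue d a / monomialValue d₀ a else 0)) := by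
    intro d hd
    split_ifs with hde
    · obtain ⟨t, ht⟩ := hline _ hde
      exact hlim d t ht
    · have hdiv : Tendsto (fun k => logWeight (exponentPoint d) (p k) - logWeight q₀ (p k)) F
          atBot := by
        refine tendsto_atBot.2 fun b => ?_
        have : ¬ ∀ᶠ k in F, logWeight q₀ (p k) - logWeight (exponentPoint d) (p k) ≤ -b :=
          fun h => hde ⟨hsuppΔ d hd, -b, h⟩
        filter_upwards [Ultrafilter.eventually_not.2 this] with k hk
        linarith [not_le.1 hk]
      rw [tendsto_zero_iff_norm_tendsto_zero]
      refine (Real.tendsto_exp_atBot.comp hdiv).congr fun k => ?_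
      rw [norm_div, norm_monomialValue (hp k), norm_monomialValue (hp k), ← Real.exp_sub]
      rfl
  set S := f.support.filter (fun d => exponentPoint d ∈ e) with hS
  have hsum : ∀ κ : (Fin 2 →₀ ℕ) → ℂ,
      Tendsto (fun k => (∑ d ∈ f.support, κ d * monomialValue d (p k)) / monomialValue d₀ (p k))
        F (𝓝 0) → ∑ d ∈ S, κ d * monomialValue d a = 0 := by
    intro κ hκ
    have h1 := tendsto_finsetSum f.support fun d hd => (hratio d hd).const_mul (κ d)
    have h2 := tendsto_nhds_unique hκ (h1.congr fun k => by
      rw [Finset.sum_div]; exact Finset.sum_congr rfl fun d _ => by ring)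
    have hne := monomialValue_ne_zero ha d₀
    rw [← mul_right_inj' (inv_ne_zero hne), mul_zero, h2, hS, Finset.sum_filter, Finset.mul_sum]
    refine Finset.sum_congr rfl fun d _ => ?_
    split_ifs
    · field_simp
    · simp
  have hfS : f = ∑ d ∈ f.support, monomial d (coeff d f) := f.as_sum
  have hval : ∑ d ∈ S, coeff d f * monomialValue d a = 0 := by
    refine hsum _ ?_
    rw [tendsto_zero_iff_norm_tendsto_zero]
    have hB0 : Tendsto (fun k => B / ‖monomialValue d₀ (p k)‖) F (𝓝 0) :=
      tendsto_const_nhds.div_atTop hnorm_top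
    refine squeeze_zero' (Eventually.of_forall fun _ => norm_nonneg _) ?_ hB0
    filter_upwards [hB] with k hk
    rw [← eval_sum_monomial, ← hfS, norm_div]
    gcongr
  have hder : ∀ i, ∑ d ∈ S, (coeff d f * d i) * monomialValue d a = 0 := by
    intro i
    refine hsum _ ?_
    rw [tendsto_zero_iff_norm_tendsto_zero]
    refine squeeze_zero' (Eventually.of_forall fun _ => norm_nonneg _) ?_
      (tendsto_zero_iff_norm_tendsto_zero.1 (hgrad i))
    filter_upwards [hle] with k hk
    rw [← mul_eval_pderiv_sum_monomial, ← hfS, norm_div, norm_mul]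
    exact div_le_of_le_mul₀ (norm_nonneg _) (norm_nonneg _)
      (by rw [mul_comm]; gcongr; exact hk i)
  by_cases hv0 : v = 0
  · have hS1 : S = {d₀} := by
      ext d
      simp only [hS, Finset.mem_filter, Finset.mem_singleton]
      constructor
      · rintro ⟨-, hd⟩
        obtain ⟨t, ht⟩ := hline _ hd
        exact exponentPoint_injective (by simpa [hv0] using ht)
      · rintro rfl
        exact ⟨hd₀, hq₀e⟩
    rw [hS1, Finset.sum_singleton] at hval
    exact mul_ne_zero (mem_support_iff.1 hd₀) (monomialValue_ne_zero ha d₀) hval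
  · have hve := hv.resolve_left hv0
    have hside : IsSide (newtonPolygon f) e := by
      refine ⟨isExtreme_dominantFace hmax, convex_dominantFace (convex_convexHull ℝ _), ?_⟩
      have : vectorSpan ℝ e = Submodule.span ℝ {v} := by
        rw [vectorSpan_eq_span_vsub_set_right ℝ hq₀e]
        apply le_antisymm
        · rw [Submodule.span_le]
          rintro _ ⟨x, hx, rfl⟩
          obtain ⟨t, rfl⟩ := hline x hx
          simpa using Submodule.smul_mem _ t (Submodule.mem_span_singleton_self v)
        · rw [Submodule.span_singleton_le_iff_mem]
          exact Submodule.subset_span ⟨_, hve, by simp⟩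
      rw [direction_affineSpan, this, finrank_span_singleton hv0]
    have haxis : ¬ (e ⊆ {p : ℝ × ℝ | p.1 = 0} ∨ e ⊆ {p : ℝ × ℝ | p.2 = 0}) := by
      have key : ∀ {x c l : ℝ} {k : ι}, c ≠ 0 → |c * l| ≤ C → x * l ≤ |x| * (C / |c|) := by
        intro x c l k hc h
        have h1 : |l| ≤ C / |c| := by
          rw [le_div_iff₀ (abs_pos.2 hc), mul_comm, ← abs_mul]; exact h
        calc x * l ≤ |x * l| := le_abs_self _
          _ = |x| * |l| := abs_mul _ _
          _ ≤ _ := by gcongr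
      rintro (h | h)
      · have h1 : q₀.1 = 0 := h hq₀e
        have h2 : v.1 = 0 := by simpa [h1] using h hve
        have h3 : v.2 ≠ 0 := fun h3 => hv0 (Prod.ext h2 h3)
        obtain ⟨k, hk, hk'⟩ := (hC.and (hMtop.eventually_gt_atTop (|q₀.2| * (C / |v.2|)))).exists
        simp only [logWeight, h1, h2, zero_mul, zero_add] at hk hk'
        exact absurd hk' (not_lt.2 (key (k := k) h3 hk))
      · have h1 : q₀.2 = 0 := h hq₀e
        have h2 : v.2 = 0 := by simpa [h1] using h hve
        have h3 : v.1 ≠ 0 := fun h3 => hv0 (Prod.ext h3 h2)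
        obtain ⟨k, hk, hk'⟩ := (hC.and (hMtop.eventually_gt_atTop (|q₀.1| * (C / |v.1|)))).exists
        simp only [logWeight, h1, h2, zero_mul, add_zero] at hk hk'
        exact absurd hk' (not_lt.2 (key (k := k) h3 hk))
    have hpoly : sidePoly f e = ∑ d ∈ S, monomial d (coeff d f) := by
      unfold sidePoly
      exact Finset.sum_congr (Finset.ext fun d => by
        rw [hS, Finset.mem_filter, Finset.mem_filter]; rfl) fun _ _ => rfl
    have ha2 : ![a 0, a 1] = a := by
      ext i; fin_cases i <;> rfl
    have hzero : ∀ i, eval a (pderiv i (sidePoly f e)) = 0 := fun i =>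
      (mul_eq_zero.1 ((hpoly ▸ mul_eval_pderiv_sum_monomial S _ a i).trans (hder i))).resolve_left
        (ha i)
    have := hnd e hside haxis (a 0) (a 1) (ha 0) (ha 1) (by
      rw [ha2, hpoly, eval_sum_monomial, hval])
    rw [ha2, hzero 0, hzero 1] at this
    simp at this

end Tameness

section Gradient

open Set Filter Topology Metric

/-- The squared Hermitian norm of the gradient of `f`. -/
noncomputable def gradNormSq (f : MvPolynomial (Fin 2) ℂ) (p : Fin 2 → ℂ) : ℝ :=
  ∑ i, ‖eval p (pderiv i f)‖ ^ 2

lemma continuous_gradNormSq (f : MvPolynomial (Fin 2) ℂ) : Continuous (gradNormSq f) :=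
  continuous_finsetSum _ fun i _ => ((pderiv i f).continuous_eval.norm.pow 2)

lemma gradNormSq_nonneg (f : MvPolynomial (Fin 2) ℂ) (p : Fin 2 → ℂ) : 0 ≤ gradNormSq f p :=
  Finset.sum_nonneg fun _ _ => by positivity

lemma norm_eval_pderiv_sq_le (f : MvPolynomial (Fin 2) ℂ) (p : Fin 2 → ℂ) (i : Fin 2) :
    ‖eval p (pderiv i f)‖ ^ 2 ≤ gradNormSq f p :=
  Finset.single_le_sum (f := fun i => ‖eval p (pderiv i f)‖ ^ 2) (fun _ _ => by positivity)
    (Finset.mem_univ i)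

lemma dense_torus : Dense {p : Fin 2 → ℂ | ∀ i, p i ≠ 0} := by
  have := dense_pi (univ : Set (Fin 2)) fun (_ : Fin 2) _ => dense_compl_singleton (0 : ℂ)
  simpa [Set.pi] using this

/-- Malgrange's condition: near the fibre over a regular value of a tame polynomial, the gradient
is bounded away from zero. -/
theorem exists_le_gradNormSq {f : MvPolynomial (Fin 2) ℂ} (hnd : WeaklyNondegenerate f)
    {ℓ m : ℕ} (hℓ : 1 ≤ ℓ) (hm : 1 ≤ m) (hΔ : NewtonBetween f ℓ m) {ξ₀ : ℂ}
    (hξ₀ : ξ₀ ∉ criticalValues f) :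
    ∃ r > 0, ∀ p, eval p f ∈ ball ξ₀ r → r ≤ gradNormSq f p := by
  by_contra! hcon
  have hseq : ∀ n : ℕ, ∃ p : Fin 2 → ℂ, (∀ i, p i ≠ 0) ∧
      dist (eval p f) ξ₀ < 1 / ((n : ℝ) + 1) ∧ gradNormSq f p < 1 / ((n : ℝ) + 1) := by
    intro n
    obtain ⟨p, hp, hp'⟩ := hcon (1 / ((n : ℝ) + 1)) (by positivity)
    have hopen : IsOpen {p : Fin 2 → ℂ | dist (eval p f) ξ₀ < 1 / ((n : ℝ) + 1) ∧
        gradNormSq f p < 1 / ((n : ℝ) + 1)} :=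
      (isOpen_lt (f.continuous_eval.dist continuous_const) continuous_const).inter
        (isOpen_lt (continuous_gradNormSq f) continuous_const)
    obtain ⟨q, hq, hq'⟩ := dense_torus.inter_open_nonempty _ hopen ⟨p, hp, hp'⟩
    exact ⟨q, hq', hq⟩
  choose p hp hval hgrad using hseq
  have hnhds : (hyperfilter ℕ : Filter ℕ) ≤ atTop := Nat.hyperfilter_le_atTop
  have h0 : Tendsto (fun n : ℕ => 1 / ((n : ℝ) + 1)) (hyperfilter ℕ) (𝓝 0) :=
    tendsto_one_div_add_atTop_nhds_zero_nat.mono_left hnhds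
  have hf : Tendsto (fun n => eval (p n) f) (hyperfilter ℕ) (𝓝 ξ₀) :=
    tendsto_iff_dist_tendsto_zero.2
      (squeeze_zero (fun _ => dist_nonneg) (fun n => (hval n).le) h0)
  have hN : Tendsto (fun n => gradNormSq f (p n)) (hyperfilter ℕ) (𝓝 0) :=
    squeeze_zero (fun n => gradNormSq_nonneg f _) (fun n => (hgrad n).le) h0
  have hd : ∀ i, Tendsto (fun n => eval (p n) (pderiv i f)) (hyperfilter ℕ) (𝓝 0) := by
    intro i
    have h : Tendsto (fun n => ‖eval (p n) (pderiv i f)‖ ^ 2) (hyperfilter ℕ) (𝓝 0) :=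
      squeeze_zero (fun _ => by positivity) (fun n => norm_eval_pderiv_sq_le f _ i) hN
    rw [tendsto_zero_iff_norm_tendsto_zero]
    simpa using h.sqrt
  by_cases hb : ∃ R, ∀ᶠ n in (hyperfilter ℕ : Filter ℕ), ‖p n‖ ≤ R
  · obtain ⟨R, hR⟩ := hb
    obtain ⟨q, -, hq⟩ := (isCompact_closedBall (0 : Fin 2 → ℂ) R).ultrafilter_le_nhds'
      ((hyperfilter ℕ).map p) (by
        change ∀ᶠ n in (hyperfilter ℕ : Filter ℕ), p n ∈ closedBall 0 R
        filter_upwards [hR] with n hn using mem_closedBall_zero_iff.2 hn)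
    have hq' : Tendsto p (hyperfilter ℕ) (𝓝 q) := hq
    have hcr : ∀ i, eval q (pderiv i f) = 0 := fun i =>
      tendsto_nhds_unique (((pderiv i f).continuous_eval.tendsto q).comp hq') (hd i)
    exact hξ₀ ⟨q, hcr 0, hcr 1,
      tendsto_nhds_unique ((f.continuous_eval.tendsto q).comp hq') hf⟩
  · simp only [not_exists, ← Ultrafilter.eventually_not, not_le] at hb
    refine not_tendsto_pderiv_zero hnd hℓ hm hΔ (F := hyperfilter ℕ) hp (fun C => ?_)
      (B := ‖ξ₀‖ + 1) ?_ hd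
    · filter_upwards [hb (Real.exp C)] with n hn
      by_contra! hle
      refine hn.not_ge ((pi_norm_le_iff_of_nonneg (Real.exp_pos C).le).2 fun i => ?_)
      rw [← Real.log_le_iff_le_exp (norm_pos_iff.2 (hp n i))]
      rw [max_le_iff] at hle
      fin_cases i
      exacts [hle.1, hle.2]
    · exact (hf.norm.eventually_lt_const (lt_add_one _)).mono fun _ h => h.le

/-- The differential of a polynomial map is given by its formal partial derivatives. -/
theorem hasFDerivAt_eval (f : MvPolynomial (Fin 2) ℂ) (p : Fin 2 → ℂ) :
    HasFDerivAt (fun p => eval p f)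
      (∑ i, eval p (pderiv i f) • ContinuousLinearMap.proj (R := ℂ) (φ := fun _ : Fin 2 => ℂ) i)
      p := by
  induction f using MvPolynomial.induction_on with
  | C a =>
    simp only [eval_C]
    exact (hasFDerivAt_const a p).congr_fderiv (by ext v; simp)
  | add f g hf hg =>
    simp only [map_add]
    refine (hf.add hg).congr_fderiv ?_
    ext v
    simp [Fin.sum_univ_two]
    ring
  | mul_X f j hf =>
    have h := hf.mul (hasFDerivAt_apply (𝕜 := ℂ) j p)
    simp only [map_mul, eval_X]
    refine h.congr_fderiv ?_
    ext v
    fin_cases j <;> simp [Derivation.leibniz, Fin.sum_univ_two, pderiv_X] <;> ring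

lemma contDiff_eval (f : MvPolynomial (Fin 2) ℂ) :
    ContDiff ℝ 1 fun p : Fin 2 → ℂ => eval p f := by
  induction f using MvPolynomial.induction_on with
  | C a => simpa using contDiff_const
  | add f g hf hg => simpa using hf.add hg
  | mul_X f j hf => simpa using hf.mul (contDiff_apply ℝ ℂ j)

/-- The vector field that `f` maps to the unit field wherever `c ≤ ‖∇f‖²`, and to a shorter
field in the same direction elsewhere. -/
noncomputable def liftField (f : MvPolynomial (Fin 2) ℂ) (c : ℝ) (p : Fin 2 → ℂ) : Fin 2 → ℂ :=
  fun i => (((max (gradNormSq f p) c)⁻¹ : ℝ) : ℂ) * starRingEnd ℂ (eval p (pderiv i f))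

lemma sum_eval_pderiv_mul_liftField (f : MvPolynomial (Fin 2) ℂ) (c : ℝ) (p : Fin 2 → ℂ) :
    ∑ i, eval p (pderiv i f) * liftField f c p i =
      ((gradNormSq f p / max (gradNormSq f p) c : ℝ) : ℂ) := by
  simp only [liftField, div_eq_mul_inv, gradNormSq, Finset.sum_mul, Complex.ofReal_mul,
    Complex.ofReal_sum, Complex.ofReal_pow, ← Complex.mul_conj']
  exact Finset.sum_congr rfl fun i _ => by ring

lemma norm_liftField_le (f : MvPolynomial (Fin 2) ℂ) {c : ℝ} (hc : 0 < c) (p : Fin 2 → ℂ) :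
    ‖liftField f c p‖ ≤ (√c)⁻¹ := by
  refine (pi_norm_le_iff_of_nonneg (by positivity)).2 fun i => ?_
  set M := max (gradNormSq f p) c
  have hM : 0 < M := lt_max_of_lt_right hc
  have h1 : ‖eval p (pderiv i f)‖ ≤ √M :=
    Real.le_sqrt_of_sq_le ((norm_eval_pderiv_sq_le f p i).trans (le_max_left _ _))
  calc ‖liftField f c p i‖ = M⁻¹ * ‖eval p (pderiv i f)‖ := by
        simp [liftField, M, abs_of_pos hM]
    _ ≤ M⁻¹ * √M := by gcongr
    _ = (√M)⁻¹ := by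
        field_simp
        rw [Real.sq_sqrt hM.le]
    _ ≤ (√c)⁻¹ := by
        gcongr
        exact le_max_right _ _

lemma contDiff_gradNormSq (f : MvPolynomial (Fin 2) ℂ) : ContDiff ℝ 1 (gradNormSq f) :=
  ContDiff.sum fun i _ => (contDiff_eval (pderiv i f)).norm_sq ℝ

lemma locallyLipschitz_inv_max {c : ℝ} (hc : 0 < c) :
    LocallyLipschitz fun x : ℝ => (max x c)⁻¹ := by
  refine (LipschitzWith.of_dist_le' (K := (c * c)⁻¹) fun x y => ?_).locallyLipschitz
  have hx : c ≤ max x c := le_max_right x c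
  have hy : c ≤ max y c := le_max_right y c
  rw [Real.dist_eq, Real.dist_eq, inv_sub_inv (hc.trans_le hx).ne' (hc.trans_le hy).ne',
    abs_div, abs_of_pos (mul_pos (hc.trans_le hx) (hc.trans_le hy)), div_eq_inv_mul]
  refine mul_le_mul (by gcongr) ?_ (abs_nonneg _) (by positivity)
  rw [abs_sub_comm]
  exact abs_max_sub_max_le_abs x y c

lemma locallyLipschitz_liftField (f : MvPolynomial (Fin 2) ℂ) {c : ℝ} (hc : 0 < c) :
    LocallyLipschitz (liftField f c) := by
  have hG : ContDiff ℝ 1 fun q : (Fin 2 → ℂ) × ℝ => fun i =>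
      (q.2 : ℂ) * starRingEnd ℂ (eval q.1 (pderiv i f)) := by
    refine contDiff_pi.2 fun i => ?_
    exact (Complex.ofRealCLM.contDiff.comp contDiff_snd).mul
      (Complex.conjCLE.contDiff.comp ((contDiff_eval _).comp contDiff_fst))
  have hpair : LocallyLipschitz fun p : Fin 2 → ℂ => (p, (max (gradNormSq f p) c)⁻¹) :=
    LocallyLipschitz.id.prodMk
      ((locallyLipschitz_inv_max hc).comp (contDiff_gradNormSq f).locallyLipschitz)
  have h := hG.locallyLipschitz.comp hpair
  unfold liftField
  exact h

end Gradient

/-- If `f` is weakly nondegenerate with respect to its Newton polygon,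
`conv{(0,0),(ℓ,0),(0,m)} ⊆ Δ_f ⊆ [0,ℓ]×[0,m]` for some `ℓ,m ≥ 1`, and the number of
integer points in the interior of `Δ_f` is positive, then `f` restricted to
`ℂ² ∖ f⁻¹(Cr_f)` is a topologically locally trivial fibration over `ℂ ∖ Cr_f`: every
regular value `ξ₀` has an open neighbourhood `V` of regular values over which `f` is
homeomorphic, fibrewise over `V`, to the projection `V × f⁻¹(ξ₀) → V`. -/
theorem locally_trivial_fibration (f : MvPolynomial (Fin 2) ℂ)
    (hnd : WeaklyNondegenerate f) (ℓ m : ℕ) (hℓ : 1 ≤ ℓ) (hm : 1 ≤ m)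
    (hΔ : NewtonBetween f ℓ m) (hg : 0 < interiorIntPoints f)
    (ξ₀ : ℂ) (hξ₀ : ξ₀ ∉ criticalValues f) :
    ∃ V : Set ℂ, IsOpen V ∧ ξ₀ ∈ V ∧ V ⊆ (criticalValues f)ᶜ ∧
      ∃ h : {p : Fin 2 → ℂ // eval p f ∈ V} ≃ₜ
          (V × {p : Fin 2 → ℂ // eval p f = ξ₀}),
        ∀ p : {p : Fin 2 → ℂ // eval p f ∈ V}, ((h p).1 : ℂ) = eval p.val f := by
  obtain ⟨r, hr, hN⟩ := exists_le_gradNormSq hnd hℓ hm hΔ hξ₀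
  refine ⟨Metric.ball ξ₀ r, Metric.isOpen_ball, Metric.mem_ball_self hr, ?_, ?_⟩
  · rintro _ hv ⟨p, h0, h1, rfl⟩
    have := hN p hv
    simp only [gradNormSq, Fin.sum_univ_two, h0, h1, norm_zero] at this
    linarith
  · have hpos : ∀ p, 0 < max (gradNormSq f p) r := fun p => lt_max_of_lt_right hr
    refine exists_homeomorph_of_lift (F := fun p => eval p f)
      (g := fun p => gradNormSq f p / max (gradNormSq f p) r)
      (locallyLipschitz_liftField f hr) (norm_liftField_le f hr) (hasFDerivAt_eval f)
      (fun p => ?_)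
      ((continuous_gradNormSq f).div ((continuous_gradNormSq f).max continuous_const)
        fun p => (hpos p).ne')
      (fun p => div_nonneg (gradNormSq_nonneg f p) (hpos p).le)
      (fun p => div_le_one_of_le₀ (le_max_left _ _) (hpos p).le) ξ₀ (fun p hp => ?_) hr
    · rw [← sum_eval_pderiv_mul_liftField]
      simp [Fin.sum_univ_two]
    · rw [max_eq_left (hN p hp)]
      exact div_self (hr.trans_le (hN p hp)).ne'
end
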